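/- (Forrester–Frankel asymptotics, Hermite case, integer q.) Let m ≥ 1, q = (q_1,…,q_m) with each q_i ∈ ℕ, q_i ≥ 1, |q| := q_1+⋯+q_m, and let μ_1,…,μ_m ∈ (−1,1) be pairwise distinct. With the Hermite weight ω_N(x) = e^{−2Nx²} on Ω = ℝ, define A_N := N^{Σ_{i=1}^m (q_i² − q_i)} · ∏_{i=1}^m e^{2N q_i μ_i²} · ∏_{i=1}^m [ (∏_{l=1}^{q_i−1} l!)² / ∏_{l=1}^{2q_i−1} l! ] · (2π)^{q_i² − q_i} · ∏_{1≤j<k≤m} |μ_k − μ_j|^{−2 q_j q_k} · ∏_{i=1}^m ( (2/π)·√(1−μ_i²) )^{q_i²}. Then there exist C > 0 and N₀ ∈ ℕ such that for all N ≥ N₀: | H_{N,N,m,q}(μ) / ( H_{N+|q|,N} · A_N ) − 1 | ≤ C/N. -/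

import Mathlib

open MeasureTheory Finset

/-- The Vandermonde product for a real tuple. -/
noncomputable def vandR {n : ℕ} (z : Fin n → ℝ) : ℝ :=
  ∏ j : Fin n, ∏ k ∈ Finset.Ioi j, (z k - z j)

/-- Andréief's identity for the square of a determinant. -/
theorem integral_det_sq_mul_prod {n : ℕ} (f : Fin n → ℝ → ℝ) (w : ℝ → ℝ)
    (hf : ∀ i j, Integrable (fun x => f i x * f j x * w x)) :
    ∫ z : Fin n → ℝ, (Matrix.of fun l j => f j (z l)).det ^ 2 * ∏ l, w (z l) =
      n.factorial * (Matrix.of fun i j => ∫ x, f i x * f j x * w x).det := by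
  have expand (z : Fin n → ℝ) : (Matrix.of fun l j => f j (z l)).det ^ 2 * ∏ l, w (z l) =
      ∑ σ : Equiv.Perm (Fin n), ∑ τ : Equiv.Perm (Fin n),
        ((Equiv.Perm.sign σ : ℤ) : ℝ) * ((Equiv.Perm.sign τ : ℤ) : ℝ) *
          ∏ l, (f (σ l) (z l) * f (τ l) (z l) * w (z l)) := by
    rw [← Matrix.det_transpose, Matrix.det_apply', sq, Finset.sum_mul_sum, Finset.sum_mul]
    refine Finset.sum_congr rfl fun σ _ => ?_
    rw [Finset.sum_mul]
    refine Finset.sum_congr rfl fun τ _ => ?_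
    simp only [Matrix.transpose_apply, Matrix.of_apply, Finset.prod_mul_distrib]
    ring
  have hint (σ τ : Equiv.Perm (Fin n)) : Integrable (fun z : Fin n → ℝ =>
      ∏ l, (f (σ l) (z l) * f (τ l) (z l) * w (z l))) :=
    Integrable.fintype_prod (f := fun l x => f (σ l) x * f (τ l) x * w x) fun l => hf (σ l) (τ l)
  simp_rw [expand]
  rw [integral_finsetSum _ fun σ _ => integrable_finsetSum _ fun τ _ =>
    (hint σ τ).const_mul _]
  have inner (σ : Equiv.Perm (Fin n)) :
      ∫ z : Fin n → ℝ, ∑ τ : Equiv.Perm (Fin n),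
        ((Equiv.Perm.sign σ : ℤ) : ℝ) * ((Equiv.Perm.sign τ : ℤ) : ℝ) *
          ∏ l, (f (σ l) (z l) * f (τ l) (z l) * w (z l)) =
      (Matrix.of fun i j => ∫ x, f i x * f j x * w x).det := by
    rw [integral_finsetSum _ fun τ _ => (hint σ τ).const_mul _]
    simp_rw [integral_const_mul,
      fun τ : Equiv.Perm (Fin n) => integral_fintype_prod_volume_eq_prod
        (f := fun l x => f (σ l) x * f (τ l) x * w x)]
    set G : Matrix (Fin n) (Fin n) ℝ := Matrix.of fun i j => ∫ x, f i x * f j x * w x with hG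
    have hperm := Matrix.det_permute σ G
    have : (∑ τ : Equiv.Perm (Fin n), ((Equiv.Perm.sign σ : ℤ) : ℝ) *
        ((Equiv.Perm.sign τ : ℤ) : ℝ) * ∏ l, ∫ x, f (σ l) x * f (τ l) x * w x) =
        ((Equiv.Perm.sign σ : ℤ) : ℝ) * (G.submatrix σ id).transpose.det := by
      rw [Matrix.det_apply', Finset.mul_sum]
      refine Finset.sum_congr rfl fun τ _ => ?_
      simp [hG, mul_assoc]
    rw [this, Matrix.det_transpose, hperm, ← mul_assoc]
    rcases Int.units_eq_one_or (Equiv.Perm.sign σ) with h | h <;> simp [h]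
  simp_rw [inner]
  simp [Fintype.card_perm]

open Polynomial in
/-- The monic Hermite polynomials orthogonal for the weight `exp (-2 t x²)`. -/
noncomputable def hermiteMonic (t : ℝ) : ℕ → ℝ[X]
  | 0 => 1
  | k + 1 => X * hermiteMonic t k - C (1 / (4 * t)) * derivative (hermiteMonic t k)

/-- The squared norm of `hermiteMonic t k` for the weight `exp (-2 t x²)`. -/
noncomputable def hermiteNorm (t : ℝ) (k : ℕ) : ℝ :=
  √(Real.pi / (2 * t)) * (k.factorial / (4 * t) ^ k)

section Hermite

open Polynomial

theorem hermiteNorm_pos {t : ℝ} (ht : 0 < t) (k : ℕ) : 0 < hermiteNorm t k := by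
  unfold hermiteNorm; positivity

theorem hermiteNorm_succ {t : ℝ} (ht : 0 < t) (k : ℕ) :
    hermiteNorm t (k + 1) = hermiteNorm t k * ((k + 1) / (4 * t)) := by
  unfold hermiteNorm
  rw [Nat.factorial_succ]
  push_cast
  field_simp
  ring

theorem derivative_hermiteMonic_succ (t : ℝ) (k : ℕ) :
    derivative (hermiteMonic t (k + 1)) = C ((k : ℝ) + 1) * hermiteMonic t k := by
  induction k with
  | zero => simp [hermiteMonic]
  | succ k ih =>
    have hrec : hermiteMonic t (k + 1) =
      X * hermiteMonic t k - C (1 / (4 * t)) * derivative (hermiteMonic t k) := rfl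
    rw [show hermiteMonic t (k + 1 + 1) = X * hermiteMonic t (k + 1) -
      C (1 / (4 * t)) * derivative (hermiteMonic t (k + 1)) from rfl, ih]
    simp only [derivative_sub, derivative_mul, derivative_X, derivative_C, ih]
    push_cast
    simp only [C_add, C_1, map_natCast]
    linear_combination (-(k : ℝ[X]) - 1) * hrec

theorem X_mul_hermiteMonic_succ (t : ℝ) (k : ℕ) :
    X * hermiteMonic t (k + 1) =
      hermiteMonic t (k + 2) + C (((k : ℝ) + 1) / (4 * t)) * hermiteMonic t k := by
  rw [show hermiteMonic t (k + 2) = X * hermiteMonic t (k + 1) -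
      C (1 / (4 * t)) * derivative (hermiteMonic t (k + 1)) from rfl,
    derivative_hermiteMonic_succ, ← mul_assoc, ← C_mul]
  rw [show 1 / (4 * t) * ((k : ℝ) + 1) = ((k : ℝ) + 1) / (4 * t) by ring]
  ring

theorem monic_natDegree_hermiteMonic (t : ℝ) (k : ℕ) :
    (hermiteMonic t k).Monic ∧ (hermiteMonic t k).natDegree = k := by
  induction k with
  | zero => simp [hermiteMonic]
  | succ k ih =>
    have hdeg : (X * hermiteMonic t k).natDegree = k + 1 := by
      rw [natDegree_X_mul ih.1.ne_zero, ih.2]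
    have hm : (X * hermiteMonic t k).Monic := monic_X.mul ih.1
    have hlt : (C (1 / (4 * t)) * derivative (hermiteMonic t k)).degree <
        (X * hermiteMonic t k).degree := by
      rw [degree_eq_natDegree hm.ne_zero, hdeg]
      rw [← smul_eq_C_mul]
      refine lt_of_le_of_lt (degree_smul_le _ _) ?_
      refine lt_of_le_of_lt (degree_derivative_le) ?_
      rw [degree_eq_natDegree ih.1.ne_zero, ih.2]
      exact_mod_cast Nat.lt_succ_self k
    refine ⟨hm.sub_of_left hlt, ?_⟩
    rw [hermiteMonic, natDegree_eq_of_degree_eq (degree_sub_eq_left_of_degree_lt hlt), hdeg]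

theorem integrable_eval_mul_exp {t : ℝ} (ht : 0 < t) (p : ℝ[X]) :
    Integrable fun x : ℝ => p.eval x * Real.exp (-2 * t * x ^ 2) := by
  induction p using Polynomial.induction_on' with
  | add p q hp hq => simpa only [eval_add, add_mul] using! hp.add hq
  | monomial n a =>
    have h := integrable_rpow_mul_exp_neg_mul_sq (b := 2 * t) (by positivity) (s := (n : ℝ))
      (by have : (0 : ℝ) ≤ n := n.cast_nonneg
          linarith)
    simpa [Real.rpow_natCast, mul_assoc] using h.const_mul a

/-- Integration of a polynomial against the weight `exp (-2 t x²)`. -/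
noncomputable def gaussInt (t : ℝ) (p : ℝ[X]) : ℝ :=
  ∫ x : ℝ, p.eval x * Real.exp (-2 * t * x ^ 2)

theorem gaussInt_add {t : ℝ} (ht : 0 < t) (p q : ℝ[X]) :
    gaussInt t (p + q) = gaussInt t p + gaussInt t q := by
  simp only [gaussInt, eval_add, add_mul]
  exact integral_add (integrable_eval_mul_exp ht p) (integrable_eval_mul_exp ht q)

theorem gaussInt_C_mul (t : ℝ) (c : ℝ) (p : ℝ[X]) :
    gaussInt t (C c * p) = c * gaussInt t p := by
  simp only [gaussInt, eval_mul, eval_C, mul_assoc, integral_const_mul]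

theorem gaussInt_sub {t : ℝ} (ht : 0 < t) (p q : ℝ[X]) :
    gaussInt t (p - q) = gaussInt t p - gaussInt t q := by
  simp only [gaussInt, eval_sub, sub_mul]
  exact integral_sub (integrable_eval_mul_exp ht p) (integrable_eval_mul_exp ht q)

theorem gaussInt_sum {t : ℝ} (ht : 0 < t) {ι : Type*} (s : Finset ι) (p : ι → ℝ[X]) :
    gaussInt t (∑ i ∈ s, p i) = ∑ i ∈ s, gaussInt t (p i) := by
  simp only [gaussInt, eval_finsetSum, Finset.sum_mul]
  exact integral_finsetSum _ fun i _ => integrable_eval_mul_exp ht (p i)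

theorem gaussInt_derivative {t : ℝ} (ht : 0 < t) (p : ℝ[X]) :
    gaussInt t (derivative p) = 4 * t * gaussInt t (X * p) := by
  have key : gaussInt t (derivative p - C (4 * t) * (X * p)) = 0 := by
    refine integral_eq_zero_of_hasDerivAt_of_integrable
      (f := fun x => p.eval x * Real.exp (-2 * t * x ^ 2)) (fun x => ?_)
      (integrable_eval_mul_exp ht _) (integrable_eval_mul_exp ht p)
    have h1 := p.hasDerivAt x
    have h2 : HasDerivAt (fun x : ℝ => Real.exp (-2 * t * x ^ 2))
        (Real.exp (-2 * t * x ^ 2) * (-2 * t * (2 * x))) x := by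
      simpa using ((hasDerivAt_pow 2 x).const_mul (-2 * t)).exp
    convert! h1.mul h2 using 1
    simp only [eval_sub, eval_mul, eval_C, eval_X]
    ring
  rw [gaussInt_sub ht, gaussInt_C_mul] at key
  linarith

theorem gaussInt_hermiteMonic_mul {t : ℝ} (ht : 0 < t) (k : ℕ) (p : ℝ[X]) :
    gaussInt t (hermiteMonic t k * p) =
      (1 / (4 * t)) ^ k * gaussInt t (derivative^[k] p) := by
  induction k generalizing p with
  | zero => simp [hermiteMonic]
  | succ k ih =>
    have h := gaussInt_derivative ht (hermiteMonic t k * p)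
    rw [derivative_mul, gaussInt_add ht] at h
    rw [Function.iterate_succ_apply, pow_succ', mul_assoc, ← ih, hermiteMonic, sub_mul,
      gaussInt_sub ht, mul_assoc (C _), gaussInt_C_mul, mul_assoc X]
    field_simp
    linarith

theorem gaussInt_hermiteMonic_mul_of_natDegree_lt {t : ℝ} (ht : 0 < t) {k : ℕ} {p : ℝ[X]}
    (h : p.natDegree < k) : gaussInt t (hermiteMonic t k * p) = 0 := by
  rw [gaussInt_hermiteMonic_mul ht, iterate_derivative_eq_zero h]
  simp [gaussInt]

theorem gaussInt_hermiteMonic_mul_self {t : ℝ} (ht : 0 < t) (k : ℕ) :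
    gaussInt t (hermiteMonic t k * hermiteMonic t k) = hermiteNorm t k := by
  have h0 : gaussInt t 1 = √(Real.pi / (2 * t)) := by
    simpa [gaussInt] using integral_gaussian (2 * t)
  induction k with
  | zero => simp [hermiteMonic, hermiteNorm, h0]
  | succ k ih =>
    have h := gaussInt_hermiteMonic_mul ht (k + 1) (hermiteMonic t (k + 1))
    have h' := gaussInt_hermiteMonic_mul ht k (C ((k : ℝ) + 1) * hermiteMonic t k)
    rw [Function.iterate_succ_apply, derivative_hermiteMonic_succ, pow_succ', mul_assoc,
      ← h', mul_left_comm, gaussInt_C_mul, ih] at h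
    rw [h, hermiteNorm_succ ht]
    ring

theorem gaussInt_hermiteMonic_mul_hermiteMonic {t : ℝ} (ht : 0 < t) (j k : ℕ) :
    gaussInt t (hermiteMonic t j * hermiteMonic t k) = if j = k then hermiteNorm t j else 0 := by
  split_ifs with h
  · rw [h, gaussInt_hermiteMonic_mul_self ht]
  · rcases lt_or_gt_of_ne h with h | h
    · rw [mul_comm]
      exact gaussInt_hermiteMonic_mul_of_natDegree_lt ht
        (by rwa [(monic_natDegree_hermiteMonic t j).2])
    · exact gaussInt_hermiteMonic_mul_of_natDegree_lt ht
        (by rwa [(monic_natDegree_hermiteMonic t k).2])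

theorem eq_sum_gaussInt_mul_hermiteMonic {t : ℝ} (ht : 0 < t) (n : ℕ) (p : ℝ[X])
    (hp : p.degree < n) :
    p = ∑ k ∈ range n,
      C (gaussInt t (hermiteMonic t k * p) / hermiteNorm t k) * hermiteMonic t k := by
  induction n generalizing p with
  | zero => simpa using hp
  | succ n ih =>
    obtain ⟨hmon, hdeg⟩ := monic_natDegree_hermiteMonic t n
    set c := p.coeff n with hc
    set r := p - C c * hermiteMonic t n with hr
    have hrdeg : r.degree < n := by
      rw [degree_lt_iff_coeff_zero]
      intro k hk
      rcases eq_or_lt_of_le hk with rfl | hk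
      · have : (hermiteMonic t n).coeff n = 1 := by
          have := hmon.coeff_natDegree
          rwa [hdeg] at this
        simp [hr, this, hc]
      · rw [hr, coeff_sub, coeff_C_mul,
          coeff_eq_zero_of_natDegree_lt (p := hermiteMonic t n) (by rwa [hdeg]),
          coeff_eq_zero_of_degree_lt (lt_of_lt_of_le hp (by exact_mod_cast hk))]
        simp
    have hpr : p = r + C c * hermiteMonic t n := by rw [hr]; ring
    have hrn : gaussInt t (hermiteMonic t n * r) = 0 := by
      by_cases hr0 : r = 0
      · simp [hr0, gaussInt]
      · exact gaussInt_hermiteMonic_mul_of_natDegree_lt ht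
          ((natDegree_lt_iff_degree_lt hr0).2 hrdeg)
    have hcoef (k : ℕ) : gaussInt t (hermiteMonic t k * p) =
        gaussInt t (hermiteMonic t k * r) + c * if k = n then hermiteNorm t k else 0 := by
      rw [hpr, mul_add, gaussInt_add ht, mul_left_comm, gaussInt_C_mul,
        gaussInt_hermiteMonic_mul_hermiteMonic ht]
    rw [Finset.sum_range_succ, hcoef n, hrn, if_pos rfl, zero_add,
      mul_div_cancel_right₀ _ (hermiteNorm_pos ht n).ne']
    rw [Finset.sum_congr rfl (g := fun k => C (gaussInt t (hermiteMonic t k * r) /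
      hermiteNorm t k) * hermiteMonic t k), ← ih r hrdeg]
    · exact hpr
    · intro k hk
      rw [hcoef, if_neg (Finset.mem_range.1 hk).ne]
      simp

end Hermite

section Duality

open Polynomial Matrix

theorem gaussInt_hermiteMonic_mul_of_degree_lt {t : ℝ} (ht : 0 < t) {k : ℕ} {p : ℝ[X]}
    (h : p.degree < k) : gaussInt t (hermiteMonic t k * p) = 0 := by
  by_cases hp : p = 0
  · simp [hp, gaussInt]
  · exact gaussInt_hermiteMonic_mul_of_natDegree_lt ht ((natDegree_lt_iff_degree_lt hp).2 h)

theorem gaussInt_hermiteMonic_mul_monic {t : ℝ} (ht : 0 < t) {k : ℕ} {p : ℝ[X]}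
    (hp : p.Monic) (hk : p.natDegree = k) :
    gaussInt t (hermiteMonic t k * p) = hermiteNorm t k := by
  obtain ⟨hmon, hdeg⟩ := monic_natDegree_hermiteMonic t k
  have hlt : (p - hermiteMonic t k).degree < k := by
    have := degree_sub_lt_left (p := p) (q := hermiteMonic t k)
      (by rw [degree_eq_natDegree hp.ne_zero, degree_eq_natDegree hmon.ne_zero, hk, hdeg])
      hp.ne_zero (by rw [hp.leadingCoeff, hmon.leadingCoeff])
    rwa [degree_eq_natDegree hp.ne_zero, hk] at this
  have h := gaussInt_hermiteMonic_mul_of_degree_lt ht hlt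
  rw [mul_sub, gaussInt_sub ht, gaussInt_hermiteMonic_mul_self ht] at h
  linarith

/-- The reproducing kernel of the polynomials of degree less than `M`, evaluated against two
linear functionals. -/
noncomputable def hermiteKernel (t : ℝ) (M : ℕ) (ℓ ℓ' : ℝ[X] →ₗ[ℝ] ℝ) : ℝ :=
  ∑ k ∈ range M, ℓ (hermiteMonic t k) * ℓ' (hermiteMonic t k) / hermiteNorm t k

variable {σ τ : Type*} [Fintype σ] [DecidableEq σ] [Fintype τ] [DecidableEq τ] {M : ℕ}

theorem sum_equiv_fin_eq_sum_range {ι : Type*} [Fintype ι] {A : Type*} [AddCommMonoid A]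
    (e : ι ≃ Fin M) (f : ℕ → A) : ∑ i, f (e i) = ∑ k ∈ range M, f k := by
  rw [Finset.sum_range, ← e.sum_comp fun k : Fin M => f k]

theorem det_gaussInt_aux {ι : Type*} [Fintype ι] [DecidableEq ι] {t : ℝ} (ht : 0 < t)
    (e : ι ≃ Fin M) (b : ι → ℝ[X]) (hmon : ∀ i, (b i).Monic)
    (hdeg : ∀ i, (b i).natDegree = e i) :
    (of fun i k : ι => gaussInt t (hermiteMonic t (e k) * b i) / hermiteNorm t (e k)).det = 1 := by
  rw [← Matrix.det_submatrix_equiv_self e.symm, Matrix.det_of_isLowerTriangular]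
  · refine Finset.prod_eq_one fun i _ => ?_
    simp only [submatrix_apply, of_apply, Equiv.apply_symm_apply]
    rw [gaussInt_hermiteMonic_mul_monic ht (hmon _) (by simp [hdeg]),
      div_self (hermiteNorm_pos ht _).ne']
  · intro i k hik
    have hik : i < k := hik
    simp only [submatrix_apply, of_apply, Equiv.apply_symm_apply]
    rw [gaussInt_hermiteMonic_mul_of_natDegree_lt ht, zero_div]
    simpa [hdeg] using hik

theorem det_gaussInt_mul_eq_prod_hermiteNorm {ι : Type*} [Fintype ι] [DecidableEq ι] {t : ℝ}
    (ht : 0 < t) (e : ι ≃ Fin M) (b : ι → ℝ[X]) (hmon : ∀ i, (b i).Monic)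
    (hdeg : ∀ i, (b i).natDegree = e i) :
    (of fun i j => gaussInt t (b i * b j)).det = ∏ k ∈ range M, hermiteNorm t k := by
  set T : Matrix ι ι ℝ :=
    of fun i k => gaussInt t (hermiteMonic t (e k) * b i) / hermiteNorm t (e k) with hT
  have hb (i : ι) : b i = ∑ k, C (T i k) * hermiteMonic t (e k) := by
    have h := eq_sum_gaussInt_mul_hermiteMonic ht M (b i) (by
      rw [degree_eq_natDegree (hmon i).ne_zero, hdeg]; exact_mod_cast (e i).2)
    rw [← sum_equiv_fin_eq_sum_range e] at h
    exact h
  have hG : (of fun i j => gaussInt t (b i * b j)) =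
      T * diagonal (fun k => hermiteNorm t (e k)) * Tᵀ := by
    ext i j
    rw [of_apply, hb j, Finset.mul_sum, gaussInt_sum ht, mul_apply]
    refine Finset.sum_congr rfl fun k _ => ?_
    rw [mul_left_comm, gaussInt_C_mul, mul_diagonal, transpose_apply, mul_comm (b i)]
    have := (hermiteNorm_pos ht (e k)).ne'
    simp only [hT, of_apply]
    field_simp
  rw [hG, det_mul, det_mul, det_transpose, det_gaussInt_aux ht e b hmon hdeg, det_diagonal,
    Finset.prod_range, ← e.prod_comp fun k : Fin M => hermiteNorm t k]
  ring

theorem det_hermiteKernel_mul_prod {t : ℝ} (ht : 0 < t) (e : σ ⊕ τ ≃ Fin M)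
    (b : σ ⊕ τ → ℝ[X]) (hmon : ∀ i, (b i).Monic) (hdeg : ∀ i, (b i).natDegree = e i)
    (ℓ : σ → ℝ[X] →ₗ[ℝ] ℝ) (hℓ : ∀ s k, ℓ s (b (Sum.inr k)) = 0) :
    (of fun s s' => hermiteKernel t M (ℓ s) (ℓ s')).det * ∏ k ∈ range M, hermiteNorm t k =
      (of fun s s' => ℓ s (b (Sum.inl s'))).det ^ 2 *
        (of fun k k' : τ => gaussInt t (b (Sum.inr k) * b (Sum.inr k'))).det := by
  set T : Matrix (σ ⊕ τ) (σ ⊕ τ) ℝ :=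
    of fun i k => gaussInt t (hermiteMonic t (e k) * b i) / hermiteNorm t (e k) with hT
  have hb (i : σ ⊕ τ) : b i = ∑ k, C (T i k) * hermiteMonic t (e k) := by
    have h := eq_sum_gaussInt_mul_hermiteMonic ht M (b i) (by
      rw [degree_eq_natDegree (hmon i).ne_zero, hdeg]; exact_mod_cast (e i).2)
    rw [← sum_equiv_fin_eq_sum_range e] at h
    exact h
  set P : Matrix σ (σ ⊕ τ) ℝ := of fun s k => ℓ s (hermiteMonic t (e k)) with hP
  set L : Matrix σ (σ ⊕ τ) ℝ := of fun s i => ℓ s (b i) with hL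
  set G : Matrix (σ ⊕ τ) (σ ⊕ τ) ℝ := of fun i j => gaussInt t (b i * b j) with hGdef
  set h : σ ⊕ τ → ℝ := fun k => hermiteNorm t (e k) with hh
  have hpos (k : σ ⊕ τ) : h k ≠ 0 := (hermiteNorm_pos ht _).ne'
  have hdetT : T.det = 1 := det_gaussInt_aux ht e b hmon hdeg
  have hLP : L = P * Tᵀ := by
    ext s i
    rw [hL, of_apply, hb i, map_sum, mul_apply]
    refine Finset.sum_congr rfl fun k _ => ?_
    rw [← smul_eq_C_mul, map_smul, smul_eq_mul, mul_comm]
    rfl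
  have hG : G = T * diagonal h * Tᵀ := by
    ext i j
    rw [hGdef, of_apply, hb j, Finset.mul_sum, gaussInt_sum ht, mul_apply]
    refine Finset.sum_congr rfl fun k _ => ?_
    rw [mul_left_comm, gaussInt_C_mul, mul_diagonal, transpose_apply, mul_comm (b i)]
    have := hpos k
    simp only [hT, of_apply, hh] at this ⊢
    field_simp
  have hTinv : Tᵀ * Tᵀ⁻¹ = 1 :=
    mul_nonsing_inv _ (by rw [det_transpose, hdetT]; exact isUnit_one)
  set Z : Matrix (σ ⊕ τ) σ ℝ := Tᵀ⁻¹ * diagonal (fun k => (h k)⁻¹) * Pᵀ with hZ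
  have hdiag : diagonal h * diagonal (fun k => (h k)⁻¹) = (1 : Matrix (σ ⊕ τ) (σ ⊕ τ) ℝ) := by
    rw [diagonal_mul_diagonal, ← diagonal_one]
    congr 1; ext k; exact mul_inv_cancel₀ (hpos k)
  have hGZ : G * Z = Lᵀ := by
    calc G * Z = T * (diagonal h * (Tᵀ * Tᵀ⁻¹) * diagonal (fun k => (h k)⁻¹)) * Pᵀ := by
          rw [hG, hZ]; simp only [Matrix.mul_assoc]
      _ = Lᵀ := by
          rw [hTinv, Matrix.mul_one, hdiag, Matrix.mul_one, hLP, transpose_mul,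
            transpose_transpose]
  have hLZ : L * Z = of fun s s' => hermiteKernel t M (ℓ s) (ℓ s') := by
    have : L * Z = P * diagonal (fun k => (h k)⁻¹) * Pᵀ := by
      calc L * Z = P * (Tᵀ * Tᵀ⁻¹) * diagonal (fun k => (h k)⁻¹) * Pᵀ := by
            rw [hLP, hZ]; simp only [Matrix.mul_assoc]
        _ = _ := by rw [hTinv, Matrix.mul_one]
    rw [this]
    ext s s'
    rw [mul_apply, of_apply, hermiteKernel, ← sum_equiv_fin_eq_sum_range e]
    refine Finset.sum_congr rfl fun k _ => ?_
    rw [mul_diagonal, transpose_apply, hP, of_apply, of_apply]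
    simp only [hh]
    ring
  set L₁ : Matrix σ σ ℝ := of fun s s' => ℓ s (b (Sum.inl s')) with hL₁
  set Z₁ : Matrix σ σ ℝ := of fun s s' => Z (Sum.inl s) s' with hZ₁
  set Z₂ : Matrix τ σ ℝ := of fun s s' => Z (Sum.inr s) s' with hZ₂
  set G₂₂ : Matrix τ τ ℝ := of fun k k' => gaussInt t (b (Sum.inr k) * b (Sum.inr k')) with hG₂
  have hLZ₁ : L₁ * Z₁ = of fun s s' => hermiteKernel t M (ℓ s) (ℓ s') := by
    rw [← hLZ]
    ext s s'
    simp only [mul_apply, Fintype.sum_sum_type]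
    simp [hL, hL₁, hZ₁, hℓ]
  have hblock : G * fromBlocks Z₁ 0 Z₂ (1 : Matrix τ τ ℝ) =
      fromBlocks L₁ᵀ (of fun s k => gaussInt t (b (Sum.inl s) * b (Sum.inr k))) 0 G₂₂ := by
    ext i j
    rcases j with s | k
    · have h1 : (G * fromBlocks Z₁ 0 Z₂ (1 : Matrix τ τ ℝ)) i (Sum.inl s) = (G * Z) i s := by
        simp only [mul_apply, Fintype.sum_sum_type]
        simp [hZ₁, hZ₂]
      rw [h1, hGZ]
      rcases i with i | i <;> simp [hL, hL₁, hℓ]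
    · have h1 : (G * fromBlocks Z₁ 0 Z₂ (1 : Matrix τ τ ℝ)) i (Sum.inr k) = G i (Sum.inr k) := by
        simp only [mul_apply, Fintype.sum_sum_type]
        simp [Matrix.one_apply]
      rw [h1]
      rcases i with i | i <;> simp [hGdef, hG₂]
  have hdet := congrArg det hblock
  rw [det_mul, det_fromBlocks_zero₁₂, det_fromBlocks_zero₂₁, det_one, mul_one, det_transpose,
    hGdef, det_gaussInt_mul_eq_prod_hermiteNorm ht e b hmon hdeg] at hdet
  rw [← hLZ₁, det_mul]
  linear_combination L₁.det * hdet

end Duality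

section Jets

open Polynomial Matrix

/-- The conjugate of the derivative on polynomials by multiplication with `e^{-t x²}`. -/
noncomputable def weightedDeriv (t : ℝ) : ℝ[X] →ₗ[ℝ] ℝ[X] :=
  derivative - (2 * t) • LinearMap.mulLeft ℝ X

/-- The functional sending `p` to the `a`-th derivative of `e^{-t x²} p` at `x`, measured in
units of `t`. -/
noncomputable def weightedJet (t : ℝ) (a : ℕ) (x : ℝ) : ℝ[X] →ₗ[ℝ] ℝ :=
  (Real.exp (-t * x ^ 2) / t ^ a) • (leval x ∘ₗ weightedDeriv t ^ a)

theorem weightedDeriv_apply (t : ℝ) (p : ℝ[X]) :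
    weightedDeriv t p = derivative p - C (2 * t) * (X * p) := by
  simp only [weightedDeriv, LinearMap.sub_apply, LinearMap.smul_apply, LinearMap.mulLeft_apply,
    smul_eq_C_mul]

theorem weightedJet_apply (t : ℝ) (a : ℕ) (x : ℝ) (p : ℝ[X]) :
    weightedJet t a x p = Real.exp (-t * x ^ 2) / t ^ a * ((weightedDeriv t ^ a) p).eval x := by
  simp [weightedJet, leval]

theorem weightedDeriv_X_mul (t : ℝ) (p : ℝ[X]) :
    weightedDeriv t (X * p) = X * weightedDeriv t p + p := by
  simp only [weightedDeriv_apply, derivative_mul, derivative_X]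
  ring

theorem weightedDeriv_pow_X_mul (t : ℝ) (a : ℕ) (p : ℝ[X]) :
    (weightedDeriv t ^ a) (X * p) =
      X * (weightedDeriv t ^ a) p + C (a : ℝ) * (weightedDeriv t ^ (a - 1)) p := by
  induction a with
  | zero => simp
  | succ a ih =>
    rw [pow_succ', Module.End.mul_apply, ih, map_add, weightedDeriv_X_mul, ← smul_eq_C_mul,
      map_smul, smul_eq_C_mul]
    have h : C (a : ℝ) * weightedDeriv t ((weightedDeriv t ^ (a - 1)) p) =
        C (a : ℝ) * (weightedDeriv t ^ a) p := by
      rcases a with _ | a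
      · simp
      · rw [Nat.add_sub_cancel, pow_succ' _ a, Module.End.mul_apply]
    rw [h, Nat.add_sub_cancel, Module.End.mul_apply]
    push_cast
    simp only [map_add, map_one]
    ring

theorem weightedJet_X_mul {t : ℝ} (ht : 0 < t) (a : ℕ) (x : ℝ) (p : ℝ[X]) :
    weightedJet t a x (X * p) =
      x * weightedJet t a x p + a / t * weightedJet t (a - 1) x p := by
  simp only [weightedJet_apply, weightedDeriv_pow_X_mul, eval_add, eval_mul, eval_X, eval_C]
  rcases a with _ | a
  · simp; ring
  · rw [Nat.add_sub_cancel, pow_succ t]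
    field_simp

theorem weightedJet_X_sub_C_mul {t : ℝ} (ht : 0 < t) (a : ℕ) (x : ℝ) (p : ℝ[X]) :
    weightedJet t a x ((X - C x) * p) = a / t * weightedJet t (a - 1) x p := by
  rw [sub_mul, map_sub, weightedJet_X_mul ht, ← smul_eq_C_mul, map_smul, smul_eq_mul]
  ring

theorem weightedJet_pow_mul_of_lt {t : ℝ} (ht : 0 < t) {a b : ℕ} (hab : a < b) (x : ℝ)
    (p : ℝ[X]) : weightedJet t a x ((X - C x) ^ b * p) = 0 := by
  induction b generalizing a with
  | zero => omega
  | succ b ih =>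
    rw [pow_succ', mul_assoc, weightedJet_X_sub_C_mul ht]
    rcases a with _ | a
    · simp
    · rw [Nat.add_sub_cancel, ih (by omega), mul_zero]

theorem weightedJet_eq_zero_of_dvd {t : ℝ} (ht : 0 < t) {a b : ℕ} (hab : a < b) {x : ℝ}
    {p : ℝ[X]} (h : (X - C x) ^ b ∣ p) : weightedJet t a x p = 0 := by
  obtain ⟨r, rfl⟩ := h
  exact weightedJet_pow_mul_of_lt ht hab x r

theorem weightedJet_mul_pow_self {t : ℝ} (ht : 0 < t) (a : ℕ) (x : ℝ) (p : ℝ[X]) :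
    weightedJet t a x (p * (X - C x) ^ a) =
      a.factorial * Real.exp (-t * x ^ 2) / t ^ a * p.eval x := by
  rw [mul_comm]
  induction a with
  | zero => simp [weightedJet_apply]
  | succ a ih =>
    rw [pow_succ' (X - C x), mul_assoc, weightedJet_X_sub_C_mul ht, Nat.add_sub_cancel, ih,
      Nat.factorial_succ]
    push_cast
    rw [pow_succ t]
    field_simp

variable {m : ℕ} (q : Fin m → ℕ) (μ : Fin m → ℝ)

/-- The monic polynomial with a zero of order `q i` at each `μ i`. -/
noncomputable def nodePoly : ℝ[X] := ∏ i, (X - C (μ i)) ^ q i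

/-- The Newton basis attached to the nodes `μ i` with multiplicities `q i`. -/
noncomputable def newtonPoly (s : (i : Fin m) × Fin (q i)) : ℝ[X] :=
  (∏ j ∈ Iio s.1, (X - C (μ j)) ^ q j) * (X - C (μ s.1)) ^ (s.2 : ℕ)

theorem monic_nodePoly : (nodePoly q μ).Monic :=
  monic_prod_of_monic _ _ fun _ _ => (monic_X_sub_C _).pow _

theorem natDegree_nodePoly : (nodePoly q μ).natDegree = ∑ i, q i := by
  rw [nodePoly, natDegree_prod_of_monic _ _ fun _ _ => (monic_X_sub_C _).pow _]
  simp

theorem monic_newtonPoly (s : (i : Fin m) × Fin (q i)) : (newtonPoly q μ s).Monic :=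
  (monic_prod_of_monic _ _ fun _ _ => (monic_X_sub_C _).pow _).mul ((monic_X_sub_C _).pow _)

theorem finSigmaFinEquiv_eq_sum_Iio (s : (i : Fin m) × Fin (q i)) :
    (finSigmaFinEquiv s : ℕ) = ∑ j ∈ Iio s.1, q j + s.2 := by
  rw [finSigmaFinEquiv_apply]
  congr 1
  refine Finset.sum_bij (fun i _ => Fin.castLE s.1.2.le i) (fun i _ => ?_) (fun i _ j _ h => ?_)
    (fun j hj => ?_) (fun i _ => rfl)
  · rw [Finset.mem_Iio, Fin.lt_def]; exact i.2
  · simpa [Fin.ext_iff] using h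
  · exact ⟨⟨j, Fin.lt_def.1 (Finset.mem_Iio.1 hj)⟩, Finset.mem_univ _, rfl⟩

theorem natDegree_newtonPoly (s : (i : Fin m) × Fin (q i)) :
    (newtonPoly q μ s).natDegree = finSigmaFinEquiv s := by
  rw [newtonPoly, Monic.natDegree_mul (monic_prod_of_monic _ _ fun _ _ => (monic_X_sub_C _).pow _)
    ((monic_X_sub_C _).pow _),
    natDegree_prod_of_monic _ _ fun _ _ => (monic_X_sub_C _).pow _, finSigmaFinEquiv_eq_sum_Iio]
  simp

theorem weightedJet_newtonPoly_of_lt {t : ℝ} (ht : 0 < t) {s s' : (i : Fin m) × Fin (q i)}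
    (h : finSigmaFinEquiv s < finSigmaFinEquiv s') :
    weightedJet t s.2 (μ s.1) (newtonPoly q μ s') = 0 := by
  obtain ⟨i, a⟩ := s
  obtain ⟨i', a'⟩ := s'
  rw [Fin.lt_def, finSigmaFinEquiv_eq_sum_Iio, finSigmaFinEquiv_eq_sum_Iio] at h
  rcases lt_trichotomy i i' with hi | rfl | hi
  · refine weightedJet_eq_zero_of_dvd ht a.2 (Dvd.dvd.mul_right ?_ _)
    exact Finset.dvd_prod_of_mem (fun j => (X - C (μ j)) ^ q j) (Finset.mem_Iio.2 hi)
  · exact weightedJet_eq_zero_of_dvd ht (by simpa using h) (dvd_mul_left _ _)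
  · exfalso
    have hsub : insert i' (Iio i') ⊆ Iio i := by
      intro j hj
      rw [Finset.mem_insert, Finset.mem_Iio] at hj
      rw [Finset.mem_Iio]
      rcases hj with rfl | hj
      · exact hi
      · exact hj.trans hi
    have hle := Finset.sum_le_sum_of_subset (f := q) hsub
    rw [Finset.sum_insert (by simp)] at hle
    have := a'.2
    simp only at h
    omega

theorem weightedJet_newtonPoly_self {t : ℝ} (ht : 0 < t) (s : (i : Fin m) × Fin (q i)) :
    weightedJet t s.2 (μ s.1) (newtonPoly q μ s) =
      (s.2 : ℕ).factorial * Real.exp (-t * μ s.1 ^ 2) / t ^ (s.2 : ℕ) *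
        ∏ j ∈ Iio s.1, (μ s.1 - μ j) ^ q j := by
  rw [newtonPoly, weightedJet_mul_pow_self ht, eval_prod]
  simp

theorem det_weightedJet_newtonPoly {t : ℝ} (ht : 0 < t) :
    (of fun s s' : (i : Fin m) × Fin (q i) =>
      weightedJet t s.2 (μ s.1) (newtonPoly q μ s')).det =
    ∏ s : (i : Fin m) × Fin (q i),
      ((s.2 : ℕ).factorial * Real.exp (-t * μ s.1 ^ 2) / t ^ (s.2 : ℕ) *
        ∏ j ∈ Iio s.1, (μ s.1 - μ j) ^ q j) := by
  rw [← Matrix.det_submatrix_equiv_self finSigmaFinEquiv.symm, Matrix.det_of_isLowerTriangular]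
  · rw [← finSigmaFinEquiv.symm.prod_comp]
    refine Finset.prod_congr rfl fun i _ => ?_
    rw [submatrix_apply, of_apply, weightedJet_newtonPoly_self q μ ht]
  · intro i k hik
    have hik : i < k := hik
    rw [submatrix_apply, of_apply]
    exact weightedJet_newtonPoly_of_lt q μ ht (by simpa using hik)

end Jets

section Partition

open Polynomial Matrix

theorem vandR_eq_det {n : ℕ} (z : Fin n → ℝ) : vandR z = (vandermonde z).det := by
  rw [det_vandermonde]; rfl

theorem integral_vandR_sq {t : ℝ} (ht : 0 < t) (M : ℕ) :
    ∫ z : Fin M → ℝ, vandR z ^ 2 * ∏ l, Real.exp (-2 * t * (z l) ^ 2) =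
      M.factorial * ∏ k ∈ range M, hermiteNorm t k := by
  have h := integral_det_sq_mul_prod (n := M) (fun j x => x ^ (j : ℕ))
    (fun x => Real.exp (-2 * t * x ^ 2)) (fun i j => by
      refine (integrable_eval_mul_exp ht (X ^ (i : ℕ) * X ^ (j : ℕ))).congr (.of_forall fun x => ?_)
      simp)
  have h2 := det_gaussInt_mul_eq_prod_hermiteNorm ht (Equiv.refl (Fin M))
    (fun i => X ^ (i : ℕ)) (fun i => monic_X_pow _) (fun i => by simp)
  simp only [vandR_eq_det]
  rw [← h2]
  simpa [gaussInt, vandermonde] using h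

theorem integral_vandR_sq_mul_nodes {m : ℕ} (q : Fin m → ℕ) (μ : Fin m → ℝ) {t : ℝ} (ht : 0 < t)
    (N : ℕ) :
    ∫ z : Fin N → ℝ, vandR z ^ 2 * (∏ l, Real.exp (-2 * t * (z l) ^ 2)) *
        ∏ l, ∏ i, |μ i - z l| ^ (2 * q i) =
      N.factorial * (of fun k k' : Fin N =>
        gaussInt t (nodePoly q μ * X ^ (k : ℕ) * (nodePoly q μ * X ^ (k' : ℕ)))).det := by
  have h := integral_det_sq_mul_prod (n := N) (fun j x => (nodePoly q μ * X ^ (j : ℕ)).eval x)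
    (fun x => Real.exp (-2 * t * x ^ 2)) (fun i j => by
      refine (integrable_eval_mul_exp ht
        (nodePoly q μ * X ^ (i : ℕ) * (nodePoly q μ * X ^ (j : ℕ)))).congr (.of_forall fun x => ?_)
      simp)
  simp only [gaussInt]
  convert h using 2
  · ext z
    have hdet : (of fun l j : Fin N => (nodePoly q μ * X ^ (j : ℕ)).eval (z l)).det =
        (∏ l, (nodePoly q μ).eval (z l)) * vandR z := by
      rw [vandR_eq_det, ← det_mul_column]
      congr 1
      ext l j
      simp [vandermonde_apply]
    rw [hdet, mul_pow, ← Finset.prod_pow]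
    have hnode (l : Fin N) : (nodePoly q μ).eval (z l) ^ 2 = ∏ i, |μ i - z l| ^ (2 * q i) := by
      rw [nodePoly, eval_prod, ← Finset.prod_pow]
      refine Finset.prod_congr rfl fun i _ => ?_
      rw [pow_mul, sq_abs, eval_pow, eval_sub, eval_X, eval_C, ← pow_mul, mul_comm (q i), pow_mul]
      congr 1
      ring
    rw [Finset.prod_congr rfl fun l _ => hnode l]
    ring
  · simp only [eval_mul]

theorem integral_nodes_mul_eq {m : ℕ} (q : Fin m → ℕ) (μ : Fin m → ℝ) {t : ℝ} (ht : 0 < t)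
    (N : ℕ) :
    (∫ z : Fin N → ℝ, vandR z ^ 2 * (∏ l, Real.exp (-2 * t * (z l) ^ 2)) *
        ∏ l, ∏ i, |μ i - z l| ^ (2 * q i)) *
      ((N + ∑ i, q i).factorial *
        (∏ s : (i : Fin m) × Fin (q i),
          ((s.2 : ℕ).factorial * Real.exp (-t * μ s.1 ^ 2) / t ^ (s.2 : ℕ) *
            ∏ j ∈ Iio s.1, (μ s.1 - μ j) ^ q j)) ^ 2) =
      (∫ z : Fin (N + ∑ i, q i) → ℝ,
        vandR z ^ 2 * ∏ l, Real.exp (-2 * t * (z l) ^ 2)) *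
      (N.factorial * (of fun s s' : (i : Fin m) × Fin (q i) =>
        hermiteKernel t (N + ∑ i, q i) (weightedJet t s.2 (μ s.1))
          (weightedJet t s'.2 (μ s'.1))).det) := by
  have hdual := det_hermiteKernel_mul_prod ht
    (((Equiv.sumCongr finSigmaFinEquiv (Equiv.refl (Fin N))).trans finSumFinEquiv).trans
      (finCongr (add_comm (∑ i, q i) N)))
    (Sum.elim (newtonPoly q μ) fun k => nodePoly q μ * X ^ (k : ℕ))
    (fun i => by
      rcases i with s | k
      · exact monic_newtonPoly q μ s
      · exact (monic_nodePoly q μ).mul (monic_X_pow _))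
    (fun i => by
      rcases i with s | k
      · simpa using natDegree_newtonPoly q μ s
      · simp [Monic.natDegree_mul (monic_nodePoly q μ) (monic_X_pow _), natDegree_nodePoly,
          add_comm])
    (fun s => weightedJet t s.2 (μ s.1))
    (fun s k => by
      refine weightedJet_eq_zero_of_dvd ht s.2.2 (Dvd.dvd.mul_right ?_ _)
      exact Finset.dvd_prod_of_mem (fun j => (X - C (μ j)) ^ q j) (Finset.mem_univ s.1))
  simp only [Sum.elim_inl, Sum.elim_inr] at hdual
  rw [det_weightedJet_newtonPoly q μ ht] at hdual
  rw [integral_vandR_sq ht, integral_vandR_sq_mul_nodes q μ ht]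
  linear_combination (-(N.factorial : ℝ) * (N + ∑ i, q i).factorial) * hdual

end Partition

section ChristoffelDarboux

open Polynomial

theorem weightedJet_weightedDeriv {t : ℝ} (ht : 0 < t) (a : ℕ) (x : ℝ) (p : ℝ[X]) :
    weightedJet t a x (weightedDeriv t p) = t * weightedJet t (a + 1) x p := by
  simp only [weightedJet_apply]
  rw [pow_succ (weightedDeriv t), Module.End.mul_apply, pow_succ t]
  field_simp

theorem hasDerivAt_weightedJet {t : ℝ} (ht : 0 < t) (a : ℕ) (x : ℝ) (p : ℝ[X]) :
    HasDerivAt (fun y => weightedJet t a y p) (t * weightedJet t (a + 1) x p) x := by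
  simp only [weightedJet_apply]
  have h1 := ((weightedDeriv t ^ a) p).hasDerivAt x
  have h2 : HasDerivAt (fun x : ℝ => Real.exp (-t * x ^ 2))
      (Real.exp (-t * x ^ 2) * (-t * (2 * x))) x := by
    simpa using ((hasDerivAt_pow 2 x).const_mul (-t)).exp
  convert! (h2.div_const (t ^ a)).mul h1 using 1
  rw [pow_succ' (weightedDeriv t), Module.End.mul_apply, weightedDeriv_apply, pow_succ t]
  simp only [eval_sub, eval_mul, eval_C, eval_X]
  field_simp
  ring

/-- The weighted Hermite polynomial of degree `M` and its derivatives in units of `t`. -/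
noncomputable def hermiteWave (t : ℝ) (M a : ℕ) (x : ℝ) : ℝ :=
  weightedJet t a x (hermiteMonic t M) / (2 * √(hermiteNorm t M))

theorem hasDerivAt_hermiteWave {t : ℝ} (ht : 0 < t) (M a : ℕ) (x : ℝ) :
    HasDerivAt (hermiteWave t M a) (t * hermiteWave t M (a + 1) x) x := by
  convert! (hasDerivAt_weightedJet ht a x (hermiteMonic t M)).div_const
    (2 * √(hermiteNorm t M)) using 1
  rw [hermiteWave, mul_div_assoc]

theorem weightedDeriv_weightedDeriv_hermiteMonic {t : ℝ} (ht : 0 < t) (M : ℕ) :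
    weightedDeriv t (weightedDeriv t (hermiteMonic t M)) =
      C (4 * t ^ 2) * (X * (X * hermiteMonic t M)) - C (t * (4 * M + 2)) * hermiteMonic t M := by
  have h : derivative (hermiteMonic t (M + 1)) = derivative (X * hermiteMonic t M -
      C (1 / (4 * t)) * derivative (hermiteMonic t M)) := rfl
  rw [derivative_hermiteMonic_succ] at h
  simp only [derivative_sub, derivative_mul, derivative_X, derivative_C] at h
  have hC : C (4 * t) * C (1 / (4 * t)) = (1 : ℝ[X]) := by
    rw [← C_mul, mul_one_div_cancel (by positivity), C_1]
  have h2 : derivative (derivative (hermiteMonic t M)) =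
      C (4 * t) * (X * derivative (hermiteMonic t M) - C (M : ℝ) * hermiteMonic t M) := by
    have h3 := congrArg (C (4 * t) * ·) h
    simp only [map_add, map_one] at h3
    linear_combination h3 - derivative (derivative (hermiteMonic t M)) * hC
  simp only [weightedDeriv_apply, derivative_sub, derivative_mul, derivative_X, derivative_C, h2]
  simp only [C_mul, C_add, C_pow, C_ofNat]
  ring

theorem hermiteWave_add_two {t : ℝ} (ht : 0 < t) (M a : ℕ) (x : ℝ) :
    hermiteWave t M (a + 2) x = -((4 * M + 2) / t - 4 * x ^ 2) * hermiteWave t M a x +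
      8 * a * x / t * hermiteWave t M (a - 1) x +
      4 * a * (a - 1 : ℕ) / t ^ 2 * hermiteWave t M (a - 1 - 1) x := by
  have h : t * (t * weightedJet t (a + 2) x (hermiteMonic t M)) =
      weightedJet t a x (weightedDeriv t (weightedDeriv t (hermiteMonic t M))) := by
    rw [weightedJet_weightedDeriv ht, weightedJet_weightedDeriv ht]
  rw [weightedDeriv_weightedDeriv_hermiteMonic ht, map_sub, ← smul_eq_C_mul, ← smul_eq_C_mul,
    map_smul, map_smul, weightedJet_X_mul ht, weightedJet_X_mul ht, weightedJet_X_mul ht] at h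
  simp only [smul_eq_mul] at h
  have h' : weightedJet t (a + 2) x (hermiteMonic t M) =
      -((4 * M + 2) / t - 4 * x ^ 2) * weightedJet t a x (hermiteMonic t M) +
      8 * a * x / t * weightedJet t (a - 1) x (hermiteMonic t M) +
      4 * a * (a - 1 : ℕ) / t ^ 2 * weightedJet t (a - 1 - 1) x (hermiteMonic t M) := by
    field_simp at h ⊢
    linear_combination h
  simp only [hermiteWave, h']
  ring

theorem hermiteKernel_X_mul_sub {t : ℝ} (ht : 0 < t) (M : ℕ) (ℓ ℓ' : ℝ[X] →ₗ[ℝ] ℝ) :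
    ∑ k ∈ range (M + 1), (ℓ (X * hermiteMonic t k) * ℓ' (hermiteMonic t k) -
        ℓ (hermiteMonic t k) * ℓ' (X * hermiteMonic t k)) / hermiteNorm t k =
      (ℓ (hermiteMonic t (M + 1)) * ℓ' (hermiteMonic t M) -
        ℓ (hermiteMonic t M) * ℓ' (hermiteMonic t (M + 1))) / hermiteNorm t M := by
  induction M with
  | zero => simp [hermiteMonic]
  | succ M ih =>
    rw [Finset.sum_range_succ, ih, X_mul_hermiteMonic_succ, map_add, map_add, ← smul_eq_C_mul,
      map_smul, map_smul, hermiteNorm_succ ht, smul_eq_mul, smul_eq_mul]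
    have := (hermiteNorm_pos ht M).ne'
    have : (M : ℝ) + 1 ≠ 0 := by positivity
    field_simp
    ring

theorem hermiteNorm_inv_mul_weightedJet {t : ℝ} (ht : 0 < t) (M a : ℕ) (x : ℝ) :
    weightedJet t a x (hermiteMonic t M) / hermiteNorm t M =
      (hermiteWave t (M + 1) (a + 1) x + 2 * x * hermiteWave t (M + 1) a x +
        2 * a / t * hermiteWave t (M + 1) (a - 1) x) / (2 * √(hermiteNorm t (M + 1))) := by
  have h : weightedDeriv t (hermiteMonic t (M + 1)) = C ((M : ℝ) + 1) * hermiteMonic t M -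
      C (2 * t) * (X * hermiteMonic t (M + 1)) := by
    rw [weightedDeriv_apply, derivative_hermiteMonic_succ]
  have h2 := weightedJet_weightedDeriv ht a x (hermiteMonic t (M + 1))
  rw [h, map_sub, ← smul_eq_C_mul, ← smul_eq_C_mul, map_smul, map_smul, weightedJet_X_mul ht,
    smul_eq_mul, smul_eq_mul] at h2
  have hpos := hermiteNorm_pos ht (M + 1)
  have hs := Real.sq_sqrt hpos.le
  have hs0 := (Real.sqrt_pos.2 hpos).ne'
  rw [hermiteNorm_succ ht] at hs
  have hM := (hermiteNorm_pos ht M).ne'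
  have hM1 : (M : ℝ) + 1 ≠ 0 := by positivity
  have hn : hermiteNorm t M = √(hermiteNorm t (M + 1)) ^ 2 * (4 * t) / (M + 1) := by
    rw [hermiteNorm_succ ht, hs]
    field_simp
  rw [hn]
  simp only [hermiteWave]
  field_simp at h2 ⊢
  linear_combination 4 * h2

/-- The Christoffel–Darboux formula for the jets of the kernel. -/
theorem hermiteKernel_weightedJet {t : ℝ} (ht : 0 < t) {M : ℕ} (hM : M ≠ 0) (a b : ℕ) (x y : ℝ) :
    (x - y) * hermiteKernel t M (weightedJet t a x) (weightedJet t b y) +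
      a / t * hermiteKernel t M (weightedJet t (a - 1) x) (weightedJet t b y) -
      b / t * hermiteKernel t M (weightedJet t a x) (weightedJet t (b - 1) y) =
    hermiteWave t M a x * (hermiteWave t M (b + 1) y + 2 * y * hermiteWave t M b y +
        2 * b / t * hermiteWave t M (b - 1) y) -
      (hermiteWave t M (a + 1) x + 2 * x * hermiteWave t M a x +
        2 * a / t * hermiteWave t M (a - 1) x) * hermiteWave t M b y := by
  obtain ⟨M, rfl⟩ := Nat.exists_eq_succ_of_ne_zero hM
  rw [Nat.succ_eq_add_one]
  have h := hermiteKernel_X_mul_sub ht M (weightedJet t a x) (weightedJet t b y)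
  have hl : (x - y) * hermiteKernel t (M + 1) (weightedJet t a x) (weightedJet t b y) +
      a / t * hermiteKernel t (M + 1) (weightedJet t (a - 1) x) (weightedJet t b y) -
      b / t * hermiteKernel t (M + 1) (weightedJet t a x) (weightedJet t (b - 1) y) =
      ∑ k ∈ range (M + 1), (weightedJet t a x (X * hermiteMonic t k) *
        weightedJet t b y (hermiteMonic t k) - weightedJet t a x (hermiteMonic t k) *
          weightedJet t b y (X * hermiteMonic t k)) / hermiteNorm t k := by
    simp only [hermiteKernel, Finset.mul_sum]
    rw [← Finset.sum_add_distrib, ← Finset.sum_sub_distrib]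
    refine Finset.sum_congr rfl fun k _ => ?_
    rw [weightedJet_X_mul ht, weightedJet_X_mul ht]
    ring
  have hpos := hermiteNorm_pos ht (M + 1)
  have hs0 := (Real.sqrt_pos.2 hpos).ne'
  rw [hl, h, sub_div, mul_div_assoc, mul_div_right_comm, hermiteNorm_inv_mul_weightedJet ht,
    hermiteNorm_inv_mul_weightedJet ht]
  have hw (c : ℕ) (z : ℝ) : weightedJet t c z (hermiteMonic t (M + 1)) =
      hermiteWave t (M + 1) c z * (2 * √(hermiteNorm t (M + 1))) := by
    rw [hermiteWave]; field_simp
  rw [hw, hw]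
  field_simp

end ChristoffelDarboux

section CentralValue

open Polynomial

/-- The squares of the normalised Hermite polynomials at the origin. -/
noncomputable def centralSq : ℕ → ℝ
  | 0 => 1
  | 1 => 0
  | k + 2 => (k + 1) / (k + 2) * centralSq k

theorem hermiteMonic_eval_zero_sq {t : ℝ} (ht : 0 < t) (k : ℕ) :
    √(Real.pi / (2 * t)) * (hermiteMonic t k).eval 0 ^ 2 = centralSq k * hermiteNorm t k := by
  induction k using Nat.twoStepInduction with
  | zero => simp [hermiteMonic, hermiteNorm, centralSq]
  | one => simp [hermiteMonic, centralSq]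
  | more k ih _ =>
    have h := congrArg (eval 0) (X_mul_hermiteMonic_succ t k)
    simp only [eval_mul, eval_X, zero_mul, eval_add, eval_C] at h
    rw [eq_neg_of_add_eq_zero_left h.symm, centralSq, hermiteNorm_succ ht, hermiteNorm_succ ht]
    push_cast
    have : (k : ℝ) + 2 ≠ 0 := by positivity
    field_simp
    linear_combination ((k : ℝ) + 2) * ih

theorem centralSq_odd (k : ℕ) : centralSq (2 * k + 1) = 0 := by
  induction k with
  | zero => rfl
  | succ k ih => rw [show 2 * (k + 1) + 1 = 2 * k + 1 + 2 by ring, centralSq, ih, mul_zero]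

theorem centralSq_even_sq (k : ℕ) :
    centralSq (2 * k) ^ 2 * ((2 * k + 1) * Real.Wallis.W k) = 1 := by
  induction k with
  | zero => simp [centralSq, Real.Wallis.W]
  | succ k ih =>
    rw [show 2 * (k + 1) = 2 * k + 2 by ring, centralSq, Real.Wallis.W_succ]
    push_cast
    refine Eq.trans ?_ ih
    have : 2 * (k : ℝ) + 2 ≠ 0 := by positivity
    have : 2 * (k : ℝ) + 3 ≠ 0 := by positivity
    field_simp
    ring

theorem abs_centralSq_add_sq_sub_le (M : ℕ) :
    |((M : ℝ) + 1) * (centralSq (M + 1) + centralSq M) ^ 2 - 2 / Real.pi| ≤ 1 / ((M : ℝ) + 1) := by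
  obtain ⟨k, hk, hc, hM⟩ : ∃ k : ℕ, (2 * (k : ℝ) ≤ M + 1 ∧ (M : ℝ) + 1 ≤ 2 * k + 1) ∧
      centralSq (M + 1) + centralSq M = centralSq (2 * k) ∧ True := by
    rcases Nat.even_or_odd' M with ⟨k, rfl | rfl⟩
    · exact ⟨k, by push_cast; constructor <;> linarith, by rw [centralSq_odd, zero_add], trivial⟩
    · refine ⟨k + 1, by push_cast; constructor <;> linarith, ?_, trivial⟩
      rw [centralSq_odd, add_zero, show 2 * k + 1 + 1 = 2 * (k + 1) by ring]
  have hW := Real.Wallis.W_pos k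
  have h1 := Real.Wallis.W_le k
  have h2 := Real.Wallis.le_W k
  have hpi := Real.pi_pos
  have hs : centralSq (2 * k) ^ 2 = 1 / ((2 * k + 1) * Real.Wallis.W k) := by
    rw [eq_div_iff (by positivity), centralSq_even_sq]
  have l1 : 2 / Real.pi ≤ 1 / Real.Wallis.W k := by
    rw [div_le_div_iff₀ hpi hW]; linarith
  have l2 : 1 / Real.Wallis.W k ≤ 2 / Real.pi * ((2 * k + 2) / (2 * k + 1)) := by
    rw [div_mul_div_comm, div_le_div_iff₀ hW (by positivity)]
    rw [div_mul_eq_mul_div, div_le_iff₀ (by positivity)] at h2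
    linarith
  have hM0 : (0 : ℝ) < M + 1 := by positivity
  have hk0 : (0 : ℝ) < 2 * k + 1 := by positivity
  have hpi2 : 2 / Real.pi ≤ 1 := by
    rw [div_le_one hpi]; exact Real.two_le_pi
  have hle : 2 / Real.pi / (2 * k + 1) ≤ 1 / ((M : ℝ) + 1) :=
    div_le_div₀ zero_le_one hpi2 hM0 hk.2
  have hr1 : (M + 1) / (2 * k + 1) ≤ (1 : ℝ) := by rw [div_le_one hk0]; exact hk.2
  have hr2 : 1 - 1 / (2 * k + 1) ≤ ((M : ℝ) + 1) / (2 * k + 1) := by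
    rw [le_div_iff₀ hk0]; field_simp; linarith
  have hr0 : (0 : ℝ) ≤ (M + 1) / (2 * k + 1) := by positivity
  have hval : ((M : ℝ) + 1) * (1 / ((2 * k + 1) * Real.Wallis.W k)) =
      (M + 1) / (2 * k + 1) * (1 / Real.Wallis.W k) := by
    field_simp
  rw [hc, hs, hval, abs_le]
  have hpp : 0 < 2 / Real.pi := by positivity
  constructor
  · have e1 : (1 - 1 / (2 * (k : ℝ) + 1)) * (2 / Real.pi) ≤
        (M + 1) / (2 * k + 1) * (1 / Real.Wallis.W k) :=
      mul_le_mul hr2 l1 hpp.le hr0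
    have e2 : (1 - 1 / (2 * (k : ℝ) + 1)) * (2 / Real.pi) =
      2 / Real.pi - 2 / Real.pi / (2 * k + 1) := by ring
    linarith
  · have e1 : (M + 1) / (2 * k + 1) * (1 / Real.Wallis.W k) ≤ 1 * (1 / Real.Wallis.W k) :=
      mul_le_mul_of_nonneg_right hr1 (by positivity)
    have e2 : 2 / Real.pi * ((2 * k + 2) / (2 * (k : ℝ) + 1)) =
      2 / Real.pi + 2 / Real.pi / (2 * k + 1) := by field_simp; ring
    linarith

/-- The amplitude of `hermiteWave` at the origin. -/
theorem hermiteWave_zero_sq {t : ℝ} (ht : 0 < t) (M : ℕ) :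
    4 * hermiteWave t (M + 1) 0 0 ^ 2 = √(2 * t / Real.pi) * centralSq (M + 1) ∧
      hermiteWave t (M + 1) 1 0 ^ 2 = (M + 1) / t * (√(2 * t / Real.pi) * centralSq M) := by
  have hpi := Real.pi_pos
  have hs : √(2 * t / Real.pi) * √(Real.pi / (2 * t)) = 1 := by
    rw [← Real.sqrt_mul (by positivity)]
    rw [show 2 * t / Real.pi * (Real.pi / (2 * t)) = 1 by field_simp, Real.sqrt_one]
  have hp := hermiteNorm_pos ht (M + 1)
  have hp0 := hermiteNorm_pos ht M
  have hsq := Real.sq_sqrt hp.le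
  have e (k : ℕ) : √(2 * t / Real.pi) * centralSq k * hermiteNorm t k =
      (hermiteMonic t k).eval 0 ^ 2 := by
    rw [mul_assoc, ← hermiteMonic_eval_zero_sq ht, ← mul_assoc, hs, one_mul]
  constructor
  · rw [hermiteWave, weightedJet_apply, div_pow, mul_pow _ (√_), hsq]
    simp only [pow_zero, Module.End.one_apply]
    have := e (M + 1)
    generalize √(2 * t / Real.pi) = c at this ⊢
    field_simp
    simp
    linear_combination -4 * this
  · rw [hermiteWave, weightedJet_apply, div_pow, mul_pow _ (√_), hsq]
    simp only [pow_one, weightedDeriv_apply, derivative_hermiteMonic_succ]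
    have := e M
    rw [hermiteNorm_succ ht]
    simp only [eval_sub, eval_mul, eval_C, eval_X]
    generalize √(2 * t / Real.pi) = c at this ⊢
    field_simp
    simp
    linear_combination -4 * ((M : ℝ) + 1) ^ 2 * this

end CentralValue

section Transport

theorem abs_sub_le_of_abs_deriv_le {F F' : ℝ → ℝ} {κ r : ℝ} (hr : r ≤ 1) (hκ0 : 0 ≤ κ)
    (hκ : κ ≤ 1) (hF : ∀ x, |x| ≤ r → HasDerivAt F (F' x) x)
    (hF' : ∀ x, |x| ≤ r → |F' x| ≤ κ * F x) {x : ℝ} (hx : |x| ≤ r) (h0 : 0 ≤ F 0) :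
    |F x - F 0| ≤ 2 * κ * F 0 := by
  have hr0 : 0 ≤ r := (abs_nonneg x).trans hx
  have hd (c : ℝ) (y : ℝ) (hy : |y| ≤ r) : HasDerivAt (fun z => F z * Real.exp (c * z))
      ((F' y + c * F y) * Real.exp (c * y)) y := by
    have h1 : HasDerivAt (fun z => Real.exp (c * z)) (Real.exp (c * y) * c) y := by
      simpa using ((hasDerivAt_id y).const_mul c).exp
    convert! (hF y hy).mul h1 using 1
    ring
  have hmono : MonotoneOn (fun z => F z * Real.exp (κ * z)) (Set.Icc (-r) r) := by
    refine monotoneOn_of_deriv_nonneg (convex_Icc _ _)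
      (fun y hy => (hd κ y (abs_le.2 hy)).continuousAt.continuousWithinAt)
      (fun y hy => (hd κ y (abs_le.2
        (interior_subset (s := Set.Icc (-r) r) hy))).differentiableAt.differentiableWithinAt)
      fun y hy => ?_
    rw [(hd κ y (abs_le.2 (interior_subset (s := Set.Icc (-r) r) hy))).deriv]
    have := (abs_le.1 (hF' y (abs_le.2 (interior_subset (s := Set.Icc (-r) r) hy)))).1
    exact mul_nonneg (by linarith) (Real.exp_pos _).le
  have hanti : AntitoneOn (fun z => F z * Real.exp (-κ * z)) (Set.Icc (-r) r) := by
    refine antitoneOn_of_deriv_nonpos (convex_Icc _ _)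
      (fun y hy => (hd (-κ) y (abs_le.2 hy)).continuousAt.continuousWithinAt)
      (fun y hy =>
        (hd (-κ) y (abs_le.2
          (interior_subset (s := Set.Icc (-r) r) hy))).differentiableAt.differentiableWithinAt)
      fun y hy => ?_
    rw [(hd (-κ) y (abs_le.2 (interior_subset (s := Set.Icc (-r) r) hy))).deriv]
    have := (abs_le.1 (hF' y (abs_le.2 (interior_subset (s := Set.Icc (-r) r) hy)))).2
    exact mul_nonpos_of_nonpos_of_nonneg (by linarith) (Real.exp_pos _).le
  have h0m : (0 : ℝ) ∈ Set.Icc (-r) r := ⟨by linarith, hr0⟩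
  have hxm : x ∈ Set.Icc (-r) r := abs_le.1 hx
  have key : ∃ u v : ℝ, |u| ≤ κ ∧ |v| ≤ κ ∧ F 0 * Real.exp u ≤ F x ∧ F x ≤ F 0 * Real.exp v := by
    have hux : |κ * x| ≤ κ := by
      rw [abs_mul, abs_of_nonneg hκ0]
      exact mul_le_of_le_one_right hκ0 (hx.trans hr)
    have e1 : Real.exp (κ * x) * Real.exp (-(κ * x)) = 1 := by
      rw [← Real.exp_add, add_neg_cancel, Real.exp_zero]
    have p1 := Real.exp_pos (κ * x)
    have p2 := Real.exp_pos (-(κ * x))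
    rcases le_total 0 x with hx0 | hx0
    · have h1 := hmono h0m hxm hx0
      have h2 := hanti h0m hxm hx0
      simp only [mul_zero, Real.exp_zero, mul_one, neg_mul] at h1 h2
      refine ⟨-(κ * x), κ * x, by rwa [abs_neg], hux, ?_, ?_⟩
      · calc F 0 * Real.exp (-(κ * x)) ≤ F x * Real.exp (κ * x) * Real.exp (-(κ * x)) := by gcongr
          _ = F x := by rw [mul_assoc, e1, mul_one]
      · calc F x = F x * Real.exp (-(κ * x)) * Real.exp (κ * x) := by
              rw [mul_assoc, mul_comm (Real.exp _), e1, mul_one]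
          _ ≤ F 0 * Real.exp (κ * x) := by gcongr
    · have h1 := hmono hxm h0m hx0
      have h2 := hanti hxm h0m hx0
      simp only [mul_zero, Real.exp_zero, mul_one, neg_mul] at h1 h2
      refine ⟨κ * x, -(κ * x), hux, by rwa [abs_neg], ?_, ?_⟩
      · calc F 0 * Real.exp (κ * x) ≤ F x * Real.exp (-(κ * x)) * Real.exp (κ * x) := by gcongr
          _ = F x := by rw [mul_assoc, mul_comm (Real.exp (-_)), e1, mul_one]
      · calc F x = F x * Real.exp (κ * x) * Real.exp (-(κ * x)) := by
              rw [mul_assoc, e1, mul_one]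
          _ ≤ F 0 * Real.exp (-(κ * x)) := by gcongr
  obtain ⟨u, v, hu, hv, h1, h2⟩ := key
  have hu' := abs_le.1 (Real.abs_exp_sub_one_le (hu.trans hκ))
  have hv' := abs_le.1 (Real.abs_exp_sub_one_le (hv.trans hκ))
  rw [abs_le]
  constructor
  · have : F 0 * (1 - 2 * κ) ≤ F 0 * Real.exp u :=
      mul_le_mul_of_nonneg_left (by linarith [hu'.1]) h0
    linarith
  · have : F 0 * Real.exp v ≤ F 0 * (1 + 2 * κ) :=
      mul_le_mul_of_nonneg_left (by linarith [hv'.2]) h0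
    linarith

/-- Transport of the amplitude of an oscillating solution `f` of the Hermite equation, with
`f` and `g` satisfying a first-order system of frequency `t`. -/
theorem exists_amplitude_transport {r : ℝ} (hr : r < 1) :
    ∃ C > 0, ∀ t A : ℝ, C ≤ t → 1 ≤ A → ∀ f g : ℝ → ℝ, (∀ x, HasDerivAt f (t * g x) x) →
      (∀ x, HasDerivAt g (t * (-(4 * (A - x ^ 2)) * f x)) x) → ∀ x, |x| ≤ r →
      ∃ E, 0 ≤ E ∧ |4 * (A - x ^ 2) * f x ^ 2 + g x ^ 2 - E| ≤ C / t * E ∧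
        |E ^ 2 / (4 * (A - x ^ 2)) - (4 * A * f 0 ^ 2 + g 0 ^ 2) ^ 2 / (4 * A)| ≤
          C / t * ((4 * A * f 0 ^ 2 + g 0 ^ 2) ^ 2 / (4 * A)) := by
  rcases lt_or_ge r 0 with hr0 | hr0
  · exact ⟨1, one_pos, fun t A _ _ f g _ _ x hx => absurd (hx.trans_lt hr0) (abs_nonneg x).not_gt⟩
  set δ := 1 - r ^ 2 with hδ
  have hδ0 : 0 < δ := by rw [hδ]; nlinarith
  have hδ1 : δ ≤ 1 := by rw [hδ]; nlinarith
  refine ⟨16 / δ ^ 3, by positivity, fun t A ht hA f g hf hg x hx => ?_⟩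
  have ht0 : 0 < t := lt_of_lt_of_le (by positivity) ht
  have hδ3 : δ ^ 3 ≤ δ ^ 2 := pow_le_pow_of_le_one hδ0.le hδ1 (by norm_num)
  have htδ3 : 16 ≤ t * δ ^ 3 := by rwa [div_le_iff₀ (by positivity)] at ht
  have htδ2 : 16 ≤ t * δ ^ 2 := htδ3.trans (by gcongr)
  have hs {y : ℝ} (hy : |y| ≤ r) : δ ≤ A - y ^ 2 ∧ y ^ 2 ≤ 1 := by
    have : y ^ 2 ≤ r ^ 2 := by rw [← sq_abs]; gcongr
    constructor <;> nlinarith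
  set Q : ℝ → ℝ := fun y => 4 * (A - y ^ 2) * f y ^ 2 + g y ^ 2 with hQ
  set E : ℝ → ℝ := fun y => Q y + (-y / (A - y ^ 2)) / t * (f y * g y) with hE
  have hfg {y : ℝ} (hy : |y| ≤ r) : |f y * g y| ≤ Q y / (2 * δ) := by
    rw [le_div_iff₀ (by positivity), abs_mul, hQ]
    have h1 := (hs hy).1
    have h2 := two_mul_le_add_sq (|f y|) (|g y|)
    have h3 : δ * (f y ^ 2) ≤ 4 * (A - y ^ 2) * f y ^ 2 := by
      gcongr; linarith
    have h4 : δ * g y ^ 2 ≤ g y ^ 2 := mul_le_of_le_one_left (sq_nonneg _) hδ1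
    rw [sq_abs, sq_abs] at h2
    have := mul_le_mul_of_nonneg_left h2 hδ0.le
    nlinarith
  have hQ0 {y : ℝ} (hy : |y| ≤ r) : 0 ≤ Q y := by
    have := (hs hy).1
    have : 0 ≤ A - y ^ 2 := by linarith
    simp only [hQ]; positivity
  have hEQ {y : ℝ} (hy : |y| ≤ r) : |E y - Q y| ≤ 1 / (2 * δ ^ 2) / t * Q y := by
    simp only [hE, add_sub_cancel_left, abs_mul, abs_div, abs_neg]
    rw [← abs_mul, abs_of_pos ht0, abs_of_pos (hδ0.trans_le (hs hy).1)]
    have hy1 : |y| ≤ 1 := hy.trans hr.le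
    calc |y| / (A - y ^ 2) / t * |f y * g y| ≤ 1 / δ / t * (Q y / (2 * δ)) := by
          gcongr
          · exact (hs hy).1
          · exact hfg hy
      _ = _ := by field_simp
  have hQE {y : ℝ} (hy : |y| ≤ r) : Q y ≤ 2 * E y := by
    have h1 := (abs_le.1 (hEQ hy)).1
    have h2 : 1 / (2 * δ ^ 2) / t ≤ 1 / 2 := by
      rw [div_div, div_le_div_iff₀ (by positivity) (by positivity)]
      linarith
    have := mul_le_mul_of_nonneg_right h2 (hQ0 hy)
    linarith
  have hE0 {y : ℝ} (hy : |y| ≤ r) : 0 ≤ E y := by linarith [hQ0 hy, hQE hy]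
  set F : ℝ → ℝ := fun y => E y ^ 2 / (4 * (A - y ^ 2)) with hF
  set B : ℝ → ℝ := fun y => -1 / (A - y ^ 2) - 3 * y ^ 2 / (A - y ^ 2) ^ 2 with hB
  have hder (y : ℝ) (hy : |y| ≤ r) : HasDerivAt F
      (2 * E y * (B y * (f y * g y) / t) / (4 * (A - y ^ 2))) y := by
    have hs0 : A - y ^ 2 ≠ 0 := (hδ0.trans_le (hs hy).1).ne'
    have d1 : HasDerivAt (fun y : ℝ => A - y ^ 2) (-(2 * y)) y := by
      simpa using (hasDerivAt_pow 2 y).const_sub A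
    have dQ : HasDerivAt Q (4 * -(2 * y) * f y ^ 2 + 4 * (A - y ^ 2) * (2 * f y * (t * g y)) +
        2 * g y * (t * (-(4 * (A - y ^ 2)) * f y))) y := by
      convert! ((d1.const_mul 4).mul ((hf y).pow 2)).add ((hg y).pow 2) using 1
      simp
    have dr : HasDerivAt (fun z => -z / (A - z ^ 2) / t * (f z * g z))
        ((-1 * (A - y ^ 2) - (-y) * -(2 * y)) / (A - y ^ 2) ^ 2 / t * (f y * g y) +
          -y / (A - y ^ 2) / t * (t * g y * g y + f y * (t * (-(4 * (A - y ^ 2)) * f y)))) y :=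
      (((hasDerivAt_id y).neg.div d1 hs0).div_const t).mul ((hf y).mul (hg y))
    have dE : HasDerivAt E (-y / (A - y ^ 2) * E y + B y * (f y * g y) / t) y := by
      convert! dQ.add dr using 1
      simp only [hE, hQ, hB]
      generalize A - y ^ 2 = s at hs0 ⊢
      field_simp
      ring
    convert! (dE.pow 2).div (d1.const_mul 4) (mul_ne_zero four_ne_zero hs0) using 1
    simp only [Pi.pow_apply]
    generalize A - y ^ 2 = s at hs0 ⊢
    field_simp
    push_cast
    ring
  have hbd (y : ℝ) (hy : |y| ≤ r) :
      |2 * E y * (B y * (f y * g y) / t) / (4 * (A - y ^ 2))| ≤ 8 / δ ^ 3 / t * F y := by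
    have hs0 := hδ0.trans_le (hs hy).1
    have hB' : |B y| ≤ 4 / δ ^ 2 := by
      have h1 : 1 / (A - y ^ 2) ≤ 1 / δ := one_div_le_one_div_of_le hδ0 (hs hy).1
      have h2 : 3 * y ^ 2 / (A - y ^ 2) ^ 2 ≤ 3 * 1 / δ ^ 2 := by
        gcongr
        · exact (hs hy).2
        · exact (hs hy).1
      have h3 : 1 / δ ≤ 1 / δ ^ 2 :=
        one_div_le_one_div_of_le (by positivity) (by nlinarith)
      have h4 : 0 ≤ 1 / (A - y ^ 2) := by positivity
      have h5 : 0 ≤ 3 * y ^ 2 / (A - y ^ 2) ^ 2 := by positivity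
      have h6 : B y = -(1 / (A - y ^ 2) + 3 * y ^ 2 / (A - y ^ 2) ^ 2) := by rw [hB]; ring
      rw [h6, abs_neg, abs_of_nonneg (by positivity)]
      calc _ ≤ 1 / δ ^ 2 + 3 * 1 / δ ^ 2 := by linarith
        _ = _ := by ring
    have hE0' := hE0 hy
    have hfg' : |f y * g y| ≤ E y / δ := by
      refine (hfg hy).trans ?_
      rw [div_le_div_iff₀ (by positivity) hδ0]
      nlinarith [hQE hy]
    rw [abs_div, abs_mul, abs_div, abs_mul (B y), abs_of_nonneg (mul_nonneg two_pos.le hE0'),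
      abs_of_pos ht0, abs_of_pos (mul_pos four_pos hs0)]
    calc 2 * E y * (|B y| * |f y * g y| / t) / (4 * (A - y ^ 2)) ≤
        2 * E y * (4 / δ ^ 2 * (E y / δ) / t) / (4 * (A - y ^ 2)) := by gcongr
      _ = _ := by simp only [hF]; field_simp; ring
  have hκ : 8 / δ ^ 3 / t ≤ 1 := by
    rw [div_div, div_le_one (by positivity)]; linarith
  have hA0 : 0 < A := by linarith
  have hF0 : F 0 = (4 * A * f 0 ^ 2 + g 0 ^ 2) ^ 2 / (4 * A) := by
    simp [hF, hE, hQ]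
  have hfin := abs_sub_le_of_abs_deriv_le hr.le (by positivity) hκ hder hbd hx
    (by rw [hF0]; positivity)
  refine ⟨E x, hE0 hx, ?_, ?_⟩
  · rw [abs_sub_comm]
    refine (hEQ hx).trans ?_
    have e1 : 1 / (2 * δ ^ 2) / t * Q x ≤ 1 / (2 * δ ^ 2) / t * (2 * E x) := by
      gcongr; exact hQE hx
    have e2 : 1 / (2 * δ ^ 2) / t * 2 ≤ 16 / δ ^ 3 / t := by
      rw [div_mul_eq_mul_div]
      gcongr
      rw [div_mul_eq_mul_div, div_le_div_iff₀ (by positivity) (by positivity)]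
      nlinarith [pow_pos hδ0 2]
    have := mul_le_mul_of_nonneg_right e2 (hE0 hx)
    linarith
  · rw [← hF0]
    refine hfin.trans (le_of_eq ?_)
    ring

end Transport

section Rate

open Filter Asymptotics Topology

/-- Convergence of a real sequence with error `O(1/N)`. -/
def RateLim (X : ℕ → ℝ) (x : ℝ) : Prop :=
  (fun N => X N - x) =O[atTop] fun N : ℕ => (N : ℝ)⁻¹

theorem inv_natCast_isBigO_one : (fun N : ℕ => (N : ℝ)⁻¹) =O[atTop] fun _ => (1 : ℝ) :=
  tendsto_inv_atTop_nhds_zero_nat.isBigO_one ℝ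

theorem rateLim_zero_iff {X : ℕ → ℝ} :
    RateLim X 0 ↔ X =O[atTop] fun N : ℕ => (N : ℝ)⁻¹ := by
  simp [RateLim]

theorem RateLim.congr' {X Y : ℕ → ℝ} {x : ℝ} (hX : RateLim X x) (h : X =ᶠ[atTop] Y) :
    RateLim Y x :=
  IsBigO.congr' hX (h.mono fun N hN => by simp only [hN]) EventuallyEq.rfl

theorem RateLim.congr {X Y : ℕ → ℝ} {x : ℝ} (hX : RateLim X x) (h : ∀ N, X N = Y N) :
    RateLim Y x := hX.congr' (.of_forall h)

theorem rateLim_const (c : ℝ) : RateLim (fun _ => c) c := by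
  simpa [RateLim] using isBigO_zero _ _

theorem RateLim.of_abs_le {X : ℕ → ℝ} {x : ℝ} {Y : ℕ → ℝ} (C : ℝ)
    (hY : Y =O[atTop] fun _ => (1 : ℝ)) (h : ∀ᶠ N : ℕ in atTop, |X N - x| ≤ C / N * |Y N|) :
    RateLim X x := by
  have h1 : (fun N => X N - x) =O[atTop] fun N : ℕ => (N : ℝ)⁻¹ * Y N := by
    refine IsBigO.of_bound C (h.mono fun N hN => ?_)
    rw [Real.norm_eq_abs, Real.norm_eq_abs, abs_mul,
      abs_of_nonneg (a := (N : ℝ)⁻¹) (by positivity)]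
    refine hN.trans (le_of_eq ?_)
    ring
  simpa [RateLim] using h1.trans ((isBigO_refl _ _).mul hY)

theorem RateLim.isBigO_one {X : ℕ → ℝ} {x : ℝ} (hX : RateLim X x) :
    X =O[atTop] fun _ => (1 : ℝ) := by
  have h := (IsBigO.trans hX inv_natCast_isBigO_one).add (isBigO_const_const x one_ne_zero atTop)
  simpa using h

theorem RateLim.tendsto {X : ℕ → ℝ} {x : ℝ} (hX : RateLim X x) : Tendsto X atTop (𝓝 x) := by
  have h := IsBigO.trans_tendsto hX tendsto_inv_atTop_nhds_zero_nat
  simpa using h.add_const x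

theorem RateLim.add {X Y : ℕ → ℝ} {x y : ℝ} (hX : RateLim X x) (hY : RateLim Y y) :
    RateLim (fun N => X N + Y N) (x + y) :=
  (IsBigO.add hX hY).congr_left fun N => by ring

theorem RateLim.neg {X : ℕ → ℝ} {x : ℝ} (hX : RateLim X x) : RateLim (fun N => -X N) (-x) :=
  (IsBigO.neg_left hX).congr_left fun N => by ring

theorem RateLim.sub {X Y : ℕ → ℝ} {x y : ℝ} (hX : RateLim X x) (hY : RateLim Y y) :
    RateLim (fun N => X N - Y N) (x - y) :=
  (IsBigO.sub hX hY).congr_left fun N => by ring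

theorem RateLim.mul {X Y : ℕ → ℝ} {x y : ℝ} (hX : RateLim X x) (hY : RateLim Y y) :
    RateLim (fun N => X N * Y N) (x * y) := by
  have h1 : (fun N => (X N - x) * Y N) =O[atTop] fun N : ℕ => (N : ℝ)⁻¹ := by
    simpa using IsBigO.mul hX hY.isBigO_one
  have h2 : (fun N => x * (Y N - y)) =O[atTop] fun N : ℕ => (N : ℝ)⁻¹ := IsBigO.const_mul_left hY x
  exact (h1.add h2).congr_left fun N => by ring

theorem RateLim.const_mul {X : ℕ → ℝ} {x : ℝ} (c : ℝ) (hX : RateLim X x) :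
    RateLim (fun N => c * X N) (c * x) := (rateLim_const c).mul hX

theorem RateLim.pow {X : ℕ → ℝ} {x : ℝ} (hX : RateLim X x) (k : ℕ) :
    RateLim (fun N => X N ^ k) (x ^ k) := by
  induction k with
  | zero => simpa using rateLim_const 1
  | succ k ih => simpa only [pow_succ] using ih.mul hX

theorem RateLim.sum {ι : Type*} (s : Finset ι) {X : ι → ℕ → ℝ} {x : ι → ℝ}
    (h : ∀ i ∈ s, RateLim (X i) (x i)) : RateLim (fun N => ∑ i ∈ s, X i N) (∑ i ∈ s, x i) := by
  classical
  induction s using Finset.induction_on with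
  | empty => simpa using rateLim_const 0
  | insert a s ha ih =>
    simp only [Finset.sum_insert ha]
    exact (h a (Finset.mem_insert_self a s)).add
      (ih fun i hi => h i (Finset.mem_insert_of_mem hi))

theorem RateLim.prod {ι : Type*} (s : Finset ι) {X : ι → ℕ → ℝ} {x : ι → ℝ}
    (h : ∀ i ∈ s, RateLim (X i) (x i)) : RateLim (fun N => ∏ i ∈ s, X i N) (∏ i ∈ s, x i) := by
  classical
  induction s using Finset.induction_on with
  | empty => simpa using rateLim_const 1
  | insert a s ha ih =>
    simp only [Finset.prod_insert ha]
    exact (h a (Finset.mem_insert_self a s)).mul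
      (ih fun i hi => h i (Finset.mem_insert_of_mem hi))

theorem RateLim.det {ι : Type*} [Fintype ι] [DecidableEq ι] {X : ℕ → Matrix ι ι ℝ}
    {x : Matrix ι ι ℝ} (h : ∀ i j, RateLim (fun N => X N i j) (x i j)) :
    RateLim (fun N => (X N).det) x.det := by
  simp only [Matrix.det_apply']
  exact RateLim.sum _ fun σ _ => (RateLim.prod _ fun i _ => h _ _).const_mul _

theorem RateLim.mul_isBigO_one {X Y : ℕ → ℝ} (hX : RateLim X 0)
    (hY : Y =O[atTop] fun _ => (1 : ℝ)) : RateLim (fun N => X N * Y N) 0 := by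
  rw [rateLim_zero_iff] at *
  simpa using IsBigO.mul hX hY

theorem rateLim_inv_natCast : RateLim (fun N => (N : ℝ)⁻¹) 0 :=
  rateLim_zero_iff.2 (isBigO_refl _ _)

theorem RateLim.inv {X : ℕ → ℝ} {x : ℝ} (hX : RateLim X x) (hx : x ≠ 0) :
    RateLim (fun N => (X N)⁻¹) x⁻¹ := by
  have h1 : (fun N => (X N)⁻¹) =O[atTop] fun _ => (1 : ℝ) :=
    (hX.tendsto.inv₀ hx).isBigO_one ℝ
  have h2 : (fun N => (X N - x) * (-x⁻¹ * (X N)⁻¹)) =O[atTop] fun N : ℕ => (N : ℝ)⁻¹ := by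
    simpa using IsBigO.mul hX (h1.const_mul_left (-x⁻¹))
  refine IsBigO.congr' h2 ?_ EventuallyEq.rfl
  filter_upwards [hX.tendsto.eventually_ne hx] with N hN
  field_simp
  ring

theorem RateLim.div {X Y : ℕ → ℝ} {x y : ℝ} (hX : RateLim X x) (hY : RateLim Y y) (hy : y ≠ 0) :
    RateLim (fun N => X N / Y N) (x / y) := by
  simpa only [div_eq_mul_inv] using hX.mul (hY.inv hy)

theorem RateLim.of_sq {X : ℕ → ℝ} {x : ℝ} (hx : 0 < x) (hX0 : ∀ᶠ N in atTop, 0 ≤ X N)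
    (hX : RateLim (fun N => X N ^ 2) (x ^ 2)) : RateLim X x := by
  refine IsBigO.trans (IsBigO.of_bound x⁻¹ (hX0.mono fun N hN => ?_)) hX
  rw [Real.norm_eq_abs, Real.norm_eq_abs, sq_sub_sq, abs_mul,
    abs_of_pos (a := X N + x) (by positivity),
    ← mul_assoc]
  have : 1 ≤ x⁻¹ * (X N + x) := by
    rw [inv_mul_eq_div, le_div_iff₀ hx]; linarith
  exact le_mul_of_one_le_left (abs_nonneg _) this

theorem RateLim.exists_abs_sub_le {X : ℕ → ℝ} {x : ℝ} (hX : RateLim X x) :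
    ∃ C > (0 : ℝ), ∃ N₀ : ℕ, ∀ N ≥ N₀, |X N - x| ≤ C / N := by
  obtain ⟨C, hC, h⟩ := IsBigO.exists_pos hX
  obtain ⟨N₀, hN⟩ := eventually_atTop.1 h.bound
  refine ⟨C, hC, N₀, fun N hN' => (hN N hN').trans (le_of_eq ?_)⟩
  rw [Real.norm_eq_abs, abs_of_nonneg (by positivity), div_eq_mul_inv]

theorem isBigO_one_of_sq_le {X Y : ℕ → ℝ} (C : ℝ) (hY : Y =O[atTop] fun _ => (1 : ℝ))
    (h : ∀ᶠ N in atTop, X N ^ 2 ≤ C * Y N) : X =O[atTop] fun _ => (1 : ℝ) := by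
  obtain ⟨D, hD⟩ := (hY.const_mul_left C).bound
  refine IsBigO.of_bound (D + 1) ?_
  filter_upwards [h, hD] with N h1 h2
  rw [norm_one, mul_one, Real.norm_eq_abs] at *
  have h3 := h1.trans ((le_abs_self _).trans h2)
  rw [← sq_abs] at h3
  nlinarith [sq_nonneg (|X N| - 1), abs_nonneg (X N)]

end Rate

section Amplitude

open Filter Asymptotics Topology

/-- The limiting eigenvalue density of the Gaussian unitary ensemble. -/
noncomputable def semicircle (x : ℝ) : ℝ := 2 / Real.pi * √(1 - x ^ 2)

theorem semicircle_pos {x : ℝ} (hx : |x| < 1) : 0 < semicircle x := by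
  have h : x ^ 2 < 1 := by rw [← sq_abs]; exact pow_lt_one₀ (abs_nonneg x) hx two_ne_zero
  have : 0 < √(1 - x ^ 2) := Real.sqrt_pos.2 (by linarith)
  have := Real.pi_pos
  unfold semicircle; positivity

theorem semicircle_sq {x : ℝ} (hx : |x| < 1) :
    semicircle x ^ 2 = 4 * (1 - x ^ 2) / Real.pi ^ 2 := by
  have h : x ^ 2 < 1 := by rw [← sq_abs]; exact pow_lt_one₀ (abs_nonneg x) hx two_ne_zero
  rw [semicircle, mul_pow, Real.sq_sqrt (by linarith)]
  ring

theorem centralSq_nonneg (k : ℕ) : 0 ≤ centralSq k := by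
  induction k using Nat.twoStepInduction with
  | zero => simp [centralSq]
  | one => simp [centralSq]
  | more k ih _ => rw [centralSq]; positivity

theorem rateLim_natCast_add_div (n : ℕ) (c : ℝ) :
    RateLim (fun N : ℕ => (((N + n : ℕ) : ℝ) + c) / N) 1 := by
  have h := (rateLim_const 1).add (rateLim_inv_natCast.const_mul ((n : ℝ) + c))
  rw [mul_zero, add_zero] at h
  refine h.congr' ?_
  filter_upwards [eventually_ge_atTop 1] with N hN
  have : (N : ℝ) ≠ 0 := by positivity
  push_cast
  field_simp
  ring

theorem rateLim_sqrt_mul_centralSq (n : ℕ) :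
    RateLim (fun N : ℕ => √(2 * N / Real.pi) *
      (centralSq (N + n - 1 + 1) + centralSq (N + n - 1))) (2 / Real.pi) := by
  have hpi := Real.pi_pos
  have hnn (N : ℕ) := add_nonneg (centralSq_nonneg (N + n - 1 + 1)) (centralSq_nonneg (N + n - 1))
  refine RateLim.of_sq (by positivity)
    (.of_forall fun N => mul_nonneg (Real.sqrt_nonneg _) (hnn N)) ?_
  have h1 : RateLim (fun N : ℕ => ((N + n : ℕ) : ℝ) *
      (centralSq (N + n - 1 + 1) + centralSq (N + n - 1)) ^ 2) (2 / Real.pi) := by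
    refine RateLim.of_abs_le (Y := fun _ => 1) 1 (isBigO_refl _ _) ?_
    filter_upwards [eventually_ge_atTop 1] with N hN
    have h := abs_centralSq_add_sq_sub_le (N + n - 1)
    have e : (((N + n - 1 : ℕ) : ℝ) + 1) = ((N + n : ℕ) : ℝ) := by
      rw [← Nat.cast_add_one, Nat.sub_add_cancel (by omega)]
    rw [e] at h
    refine h.trans ?_
    rw [abs_one, mul_one]
    gcongr
    exact_mod_cast Nat.le_add_right N n
  have h2 := (h1.div (rateLim_natCast_add_div n 0) one_ne_zero).const_mul (2 / Real.pi)
  rw [div_one, ← sq] at h2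
  refine h2.congr' ?_
  filter_upwards [eventually_ge_atTop 1] with N hN
  have : (N : ℝ) ≠ 0 := by positivity
  have : ((N + n : ℕ) : ℝ) ≠ 0 := by positivity
  rw [mul_pow, Real.sq_sqrt (by positivity)]
  field_simp
  ring

theorem rateLim_amplitude_zero (n : ℕ) :
    RateLim (fun N : ℕ => 4 * ((((N + n : ℕ) : ℝ) + 1 / 2) / N) *
      hermiteWave N (N + n) 0 0 ^ 2 + hermiteWave N (N + n) 1 0 ^ 2) (2 / Real.pi) := by
  have h1 := rateLim_sqrt_mul_centralSq n
  have h2 : (fun N : ℕ => √(2 * N / Real.pi) * centralSq (N + n - 1)) =O[atTop]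
      fun _ => (1 : ℝ) := by
    refine IsBigO.trans (isBigO_of_le _ fun N => ?_) h1.isBigO_one
    rw [Real.norm_of_nonneg (mul_nonneg (Real.sqrt_nonneg _) (centralSq_nonneg _)),
      Real.norm_of_nonneg (mul_nonneg (Real.sqrt_nonneg _)
        (add_nonneg (centralSq_nonneg _) (centralSq_nonneg _)))]
    gcongr
    linarith [centralSq_nonneg (N + n - 1 + 1)]
  have h3 := ((rateLim_natCast_add_div n (1 / 2)).mul h1).sub
    ((rateLim_inv_natCast.mul_isBigO_one h2).const_mul (1 / 2))
  rw [one_mul, mul_zero, sub_zero] at h3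
  refine h3.congr' ?_
  filter_upwards [eventually_ge_atTop 1] with N hN
  have hN0 : (0 : ℝ) < N := by positivity
  obtain ⟨h4, h5⟩ := hermiteWave_zero_sq hN0 (N + n - 1)
  have e : (((N + n - 1 : ℕ) : ℝ) + 1) = ((N + n : ℕ) : ℝ) := by
    rw [← Nat.cast_add_one, Nat.sub_add_cancel (by omega)]
  rw [e, Nat.sub_add_cancel (by omega)] at h5
  rw [Nat.sub_add_cancel (by omega)] at h4 ⊢
  rw [h5, mul_right_comm, h4]
  ring

theorem hermiteWave_amplitude (n : ℕ) {x : ℝ} (hx : |x| < 1) :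
    RateLim (fun N : ℕ => 4 * (1 - x ^ 2) * hermiteWave N (N + n) 0 x ^ 2 +
        hermiteWave N (N + n) 1 x ^ 2) (semicircle x) ∧
      (fun N : ℕ => hermiteWave N (N + n) 0 x) =O[atTop] (fun _ => (1 : ℝ)) ∧
      (fun N : ℕ => hermiteWave N (N + n) 1 x) =O[atTop] (fun _ => (1 : ℝ)) := by
  have hx2 : x ^ 2 < 1 := by rw [← sq_abs]; exact pow_lt_one₀ (abs_nonneg x) hx two_ne_zero
  have hpi := Real.pi_pos
  obtain ⟨C, hC, htr⟩ := exists_amplitude_transport hx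
  set A : ℕ → ℝ := fun N => (((N + n : ℕ) : ℝ) + 1 / 2) / N with hAdef
  have hA : RateLim A 1 := rateLim_natCast_add_div n (1 / 2)
  have hA1 : ∀ᶠ N in atTop, 1 ≤ A N := by
    filter_upwards [eventually_ge_atTop 1] with N hN
    have hN0 : (0 : ℝ) < N := by positivity
    rw [hAdef, le_div_iff₀ hN0]
    push_cast
    linarith [n.cast_nonneg (α := ℝ)]
  have hF0 := ((rateLim_amplitude_zero n).pow 2).div (hA.const_mul 4) (by norm_num)
  have hex : ∀ᶠ N : ℕ in atTop, ∃ E, 0 ≤ E ∧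
      |4 * (A N - x ^ 2) * hermiteWave N (N + n) 0 x ^ 2 + hermiteWave N (N + n) 1 x ^ 2 - E| ≤
        C / N * E ∧
      |E ^ 2 / (4 * (A N - x ^ 2)) - (4 * A N * hermiteWave N (N + n) 0 0 ^ 2 +
        hermiteWave N (N + n) 1 0 ^ 2) ^ 2 / (4 * A N)| ≤ C / N * ((4 * A N *
          hermiteWave N (N + n) 0 0 ^ 2 + hermiteWave N (N + n) 1 0 ^ 2) ^ 2 / (4 * A N)) := by
    filter_upwards [hA1, eventually_ge_atTop 1, tendsto_natCast_atTop_atTop.eventually_ge_atTop C]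
      with N hAN hN hNC
    have hN0 : (0 : ℝ) < N := by positivity
    refine htr N (A N) hNC hAN _ _ (hasDerivAt_hermiteWave hN0 (N + n) 0) (fun y => ?_) x le_rfl
    convert! hasDerivAt_hermiteWave hN0 (N + n) 1 y using 2
    rw [hermiteWave_add_two hN0 _ 0]
    simp only [hAdef]
    push_cast
    field_simp
    ring
  obtain ⟨E, hE⟩ := hex.choice
  have hF : RateLim (fun N => E N ^ 2 / (4 * (A N - x ^ 2))) ((2 / Real.pi) ^ 2 / (4 * 1)) := by
    have := RateLim.of_abs_le (X := fun N => E N ^ 2 / (4 * (A N - x ^ 2)) -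
      (4 * A N * hermiteWave N (N + n) 0 0 ^ 2 +
        hermiteWave N (N + n) 1 0 ^ 2) ^ 2 / (4 * A N)) (x := 0) C hF0.isBigO_one (by
          filter_upwards [hE] with N hN
          rw [sub_zero]
          exact hN.2.2.trans (by gcongr; exact le_abs_self _))
    have h := this.add hF0
    rw [zero_add] at h
    exact h.congr fun N => sub_add_cancel _ _
  have hAx := hA.sub (rateLim_const (x ^ 2))
  have hAx0 : ∀ᶠ N in atTop, 0 < A N - x ^ 2 := by
    filter_upwards [hA1] with N hN; linarith
  have hE2 : RateLim E (semicircle x) := by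
    refine RateLim.of_sq (semicircle_pos hx) (hE.mono fun N hN => hN.1) ?_
    have h := (hAx.const_mul 4).mul hF
    rw [semicircle_sq hx, show 4 * (1 - x ^ 2) / Real.pi ^ 2 =
      4 * (1 - x ^ 2) * ((2 / Real.pi) ^ 2 / (4 * 1)) by ring]
    refine h.congr' ?_
    filter_upwards [hAx0] with N hN
    rw [mul_div_cancel₀ _ (by positivity)]
  have hQ : RateLim (fun N : ℕ => 4 * (A N - x ^ 2) * hermiteWave N (N + n) 0 x ^ 2 +
      hermiteWave N (N + n) 1 x ^ 2) (semicircle x) := by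
    have := RateLim.of_abs_le (X := fun N : ℕ => 4 * (A N - x ^ 2) *
      hermiteWave N (N + n) 0 x ^ 2 + hermiteWave N (N + n) 1 x ^ 2 - E N) (x := 0) C
        hE2.isBigO_one (by
          filter_upwards [hE] with N hN
          rw [sub_zero]
          exact hN.2.1.trans (by gcongr; exact le_abs_self _))
    simpa using! this.add hE2
  have hf0 : (fun N : ℕ => hermiteWave N (N + n) 0 x) =O[atTop] (fun _ => (1 : ℝ)) := by
    refine isBigO_one_of_sq_le (1 / (4 * (1 - x ^ 2))) hQ.isBigO_one ?_
    filter_upwards [hA1] with N hN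
    rw [div_mul_eq_mul_div, le_div_iff₀ (by linarith), one_mul]
    have : 4 * (1 - x ^ 2) * hermiteWave N (N + n) 0 x ^ 2 ≤
        4 * (A N - x ^ 2) * hermiteWave N (N + n) 0 x ^ 2 := by gcongr
    nlinarith [sq_nonneg (hermiteWave N (N + n) 1 x)]
  have hf1 : (fun N : ℕ => hermiteWave N (N + n) 1 x) =O[atTop] (fun _ => (1 : ℝ)) := by
    refine isBigO_one_of_sq_le 1 hQ.isBigO_one ?_
    filter_upwards [hAx0] with N hN
    rw [one_mul]
    have : 0 ≤ 4 * (A N - x ^ 2) * hermiteWave N (N + n) 0 x ^ 2 := by positivity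
    linarith
  refine ⟨?_, hf0, hf1⟩
  have h0 : RateLim (fun N => 4 * (A N - 1)) 0 := by
    simpa using (hA.sub (rateLim_const 1)).const_mul 4
  have hf2 : (fun N : ℕ => hermiteWave N (N + n) 0 x ^ 2) =O[atTop] (fun _ => (1 : ℝ)) := by
    simpa using hf0.pow 2
  have := hQ.sub (h0.mul_isBigO_one hf2)
  rw [sub_zero] at this
  exact this.congr fun N => by ring

end Amplitude

section JetLimits

open Filter Asymptotics Topology

theorem rateLim_waveNumber (n : ℕ) (x : ℝ) :
    RateLim (fun N : ℕ => (4 * ((N + n : ℕ) : ℝ) + 2) / N - 4 * x ^ 2) (4 * (1 - x ^ 2)) := by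
  have h := ((rateLim_natCast_add_div n (1 / 2)).const_mul 4).sub (rateLim_const (4 * x ^ 2))
  rw [show 4 * 1 - 4 * x ^ 2 = 4 * (1 - x ^ 2) by ring] at h
  exact h.congr fun N => by ring

theorem hermiteWave_isBigO_one (n : ℕ) {x : ℝ} (hx : |x| < 1) (a : ℕ) :
    (fun N : ℕ => hermiteWave N (N + n) a x) =O[atTop] (fun _ => (1 : ℝ)) ∧
      RateLim (fun N : ℕ => hermiteWave N (N + n) (a + 2) x +
        4 * (1 - x ^ 2) * hermiteWave N (N + n) a x) 0 := by
  have hrec (a : ℕ) (hb : ∀ b ≤ a, (fun N : ℕ => hermiteWave N (N + n) b x) =O[atTop]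
      (fun _ => (1 : ℝ))) : RateLim (fun N : ℕ => hermiteWave N (N + n) (a + 2) x +
        4 * (1 - x ^ 2) * hermiteWave N (N + n) a x) 0 := by
    have h1 := ((rateLim_waveNumber n x).sub (rateLim_const (4 * (1 - x ^ 2)))).neg
    rw [sub_self, neg_zero] at h1
    have h2 := h1.mul_isBigO_one (hb a le_rfl)
    have h3 := (rateLim_inv_natCast.const_mul (8 * a * x))
    rw [mul_zero] at h3
    have h3 := h3.mul_isBigO_one (hb (a - 1) (by omega))
    have h4 := (rateLim_inv_natCast.pow 2).const_mul (4 * a * (a - 1 : ℕ))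
    rw [zero_pow two_ne_zero, mul_zero] at h4
    have h4 := h4.mul_isBigO_one (hb (a - 1 - 1) (by omega))
    have h := (h2.add h3).add h4
    rw [add_zero, add_zero] at h
    refine h.congr' ?_
    filter_upwards [eventually_ge_atTop 1] with N hN
    rw [hermiteWave_add_two (by positivity)]
    ring
  have hO (a : ℕ) : (fun N : ℕ => hermiteWave N (N + n) a x) =O[atTop] (fun _ => (1 : ℝ)) := by
    induction a using Nat.strong_induction_on with
    | _ a ih =>
      rcases a with _ | _ | a
      · exact (hermiteWave_amplitude n hx).2.1
      · exact (hermiteWave_amplitude n hx).2.2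
      · have h1 := (hrec a fun b hb => ih b (by omega)).isBigO_one
        have h2 := (ih a (by omega)).const_mul_left (4 * (1 - x ^ 2))
        exact (h1.sub h2).congr_left fun N => by ring
  exact ⟨hO a, hrec a fun b _ => hO b⟩

/-- The value at the origin of the derivatives of the solution of the oscillator equation with
squared frequency `u`, initial value `1` and initial slope `0`. -/
def oscCos (u : ℝ) : ℕ → ℝ
  | 0 => 1
  | 1 => 0
  | a + 2 => -u * oscCos u a

/-- The value at the origin of the derivatives of the solution of the oscillator equation with
squared frequency `u`, initial value `0` and initial slope `1`. -/
def oscSin (u : ℝ) : ℕ → ℝ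
  | 0 => 0
  | a + 1 => oscCos u a

theorem oscCos_succ (u : ℝ) (a : ℕ) : oscCos u (a + 1) = -u * oscSin u a := by
  rcases a with _ | a <;> simp [oscCos, oscSin]

theorem oscSin_succ (u : ℝ) (a : ℕ) : oscSin u (a + 1) = oscCos u a := rfl

theorem rateLim_hermiteWave_sub (n : ℕ) {x : ℝ} (hx : |x| < 1) (a : ℕ) :
    RateLim (fun N : ℕ => hermiteWave N (N + n) a x -
      (oscCos (4 * (1 - x ^ 2)) a * hermiteWave N (N + n) 0 x +
        oscSin (4 * (1 - x ^ 2)) a * hermiteWave N (N + n) 1 x)) 0 := by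
  induction a using Nat.twoStepInduction with
  | zero => simpa [oscCos, oscSin] using rateLim_const 0
  | one => simpa [oscCos, oscSin] using rateLim_const 0
  | more a ih _ =>
    have h := (hermiteWave_isBigO_one n hx a).2.sub (ih.const_mul (4 * (1 - x ^ 2)))
    rw [mul_zero, sub_zero] at h
    refine h.congr fun N => ?_
    rw [oscCos_succ, oscSin_succ, oscSin_succ, oscCos_succ]
    ring

theorem rateLim_wronskian (n : ℕ) {x : ℝ} (hx : |x| < 1) (a b : ℕ) :
    RateLim (fun N : ℕ => hermiteWave N (N + n) a x * hermiteWave N (N + n) (b + 1) x -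
        hermiteWave N (N + n) (a + 1) x * hermiteWave N (N + n) b x)
      ((oscSin (4 * (1 - x ^ 2)) a * oscCos (4 * (1 - x ^ 2)) b -
        oscCos (4 * (1 - x ^ 2)) a * oscSin (4 * (1 - x ^ 2)) b) * semicircle x) := by
  set u := 4 * (1 - x ^ 2) with hu
  have hO (c : ℕ) := (hermiteWave_isBigO_one n hx c).1
  have hP (c d : ℕ) : RateLim (fun N : ℕ => hermiteWave N (N + n) c x * hermiteWave N (N + n) d x -
      (oscCos u c * hermiteWave N (N + n) 0 x + oscSin u c * hermiteWave N (N + n) 1 x) *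
        (oscCos u d * hermiteWave N (N + n) 0 x + oscSin u d * hermiteWave N (N + n) 1 x)) 0 := by
    have h1 := (rateLim_hermiteWave_sub n hx c).mul_isBigO_one (hO d)
    have h2 := (rateLim_hermiteWave_sub n hx d).mul_isBigO_one
      (((hO 0).const_mul_left (oscCos u c)).add ((hO 1).const_mul_left (oscSin u c)))
    have h := h1.add h2
    rw [add_zero] at h
    exact h.congr fun N => by ring
  have h := ((hP a (b + 1)).sub (hP (a + 1) b)).add
    ((hermiteWave_amplitude n hx).1.const_mul (oscSin u a * oscCos u b - oscCos u a * oscSin u b))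
  rw [sub_zero, zero_add] at h
  refine h.congr fun N => ?_
  rw [oscCos_succ, oscCos_succ, oscSin_succ, oscSin_succ, ← hu]
  ring

/-- The kernel jets, corrected so that the Christoffel–Darboux formula is a pure Wronskian. -/
noncomputable def waveKernel (t : ℝ) (M a b : ℕ) (x y : ℝ) : ℝ :=
  hermiteKernel t M (weightedJet t a x) (weightedJet t b y) +
    2 * (hermiteWave t M a x * hermiteWave t M b y)

theorem waveKernel_christoffel_darboux {t : ℝ} (ht : 0 < t) {M : ℕ} (hM : M ≠ 0) (a b : ℕ)
    (x y : ℝ) :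
    (x - y) * waveKernel t M a b x y + a / t * waveKernel t M (a - 1) b x y -
        b / t * waveKernel t M a (b - 1) x y =
      hermiteWave t M a x * hermiteWave t M (b + 1) y -
        hermiteWave t M (a + 1) x * hermiteWave t M b y := by
  have h := hermiteKernel_weightedJet ht hM a b x y
  simp only [waveKernel]
  linear_combination h

theorem rateLim_hermiteKernel_of_waveKernel {n : ℕ} {x y : ℝ} (hx : |x| < 1) (hy : |y| < 1)
    {a b : ℕ} {l : ℝ} (h : RateLim (fun N : ℕ => waveKernel N (N + n) a b x y / N) l) :
    RateLim (fun N : ℕ => hermiteKernel N (N + n) (weightedJet N a x) (weightedJet N b y) / N)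
      l := by
  have h1 := (hermiteWave_isBigO_one n hx a).1.mul (hermiteWave_isBigO_one n hy b).1
  simp only [mul_one] at h1
  have h2 := h.sub ((rateLim_inv_natCast.mul_isBigO_one h1).const_mul 2)
  rw [mul_zero, sub_zero] at h2
  refine h2.congr fun N => ?_
  rw [waveKernel]
  ring

theorem rateLim_waveKernel_of_ne (n : ℕ) {x y : ℝ} (hx : |x| < 1) (hy : |y| < 1) (hxy : x ≠ y)
    (a b : ℕ) : RateLim (fun N : ℕ => waveKernel N (N + n) a b x y / N) 0 := by
  induction hs : a + b using Nat.strong_induction_on generalizing a b with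
  | _ s ih =>
    have hW (c d : ℕ) : (fun N : ℕ => hermiteWave N (N + n) c x * hermiteWave N (N + n) d y)
        =O[atTop] fun _ => (1 : ℝ) := by
      simpa using (hermiteWave_isBigO_one n hx c).1.mul (hermiteWave_isBigO_one n hy d).1
    have h1 := rateLim_inv_natCast.mul_isBigO_one ((hW a (b + 1)).sub (hW (a + 1) b))
    have h2 : RateLim (fun N : ℕ => (a : ℝ) * (waveKernel N (N + n) (a - 1) b x y / N)) 0 := by
      rcases Nat.eq_zero_or_pos a with rfl | ha
      · simpa using rateLim_const 0
      · simpa using (ih (a - 1 + b) (by omega) _ _ rfl).const_mul (a : ℝ)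
    have h3 : RateLim (fun N : ℕ => (b : ℝ) * (waveKernel N (N + n) a (b - 1) x y / N)) 0 := by
      rcases Nat.eq_zero_or_pos b with rfl | hb
      · simpa using rateLim_const 0
      · simpa using (ih (a + (b - 1)) (by omega) _ _ rfl).const_mul (b : ℝ)
    have h := ((h1.sub (rateLim_inv_natCast.mul h2)).add (rateLim_inv_natCast.mul h3)).const_mul
      (x - y)⁻¹
    simp only [mul_zero, sub_zero, add_zero] at h
    refine h.congr' ?_
    filter_upwards [eventually_ge_atTop 1] with N hN
    rw [← waveKernel_christoffel_darboux (M := N + n) (by positivity) (by omega)]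
    have : x - y ≠ 0 := sub_ne_zero.2 hxy
    field_simp
    ring

theorem rateLim_waveKernel_self (n : ℕ) {x : ℝ} (hx : |x| < 1) (a b : ℕ) :
    RateLim (fun N : ℕ => waveKernel N (N + n) a b x x / N)
      ((oscCos (4 * (1 - x ^ 2)) a * oscCos (4 * (1 - x ^ 2)) b + 4 * (1 - x ^ 2) *
        (oscSin (4 * (1 - x ^ 2)) a * oscSin (4 * (1 - x ^ 2)) b)) * semicircle x /
          (a + b + 1)) := by
  set u := 4 * (1 - x ^ 2) with hu
  induction b generalizing a with
  | zero =>
    have h := (rateLim_wronskian n hx (a + 1) 0).const_mul ((a : ℝ) + 1)⁻¹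
    have e0 : oscCos u 0 = 1 := rfl
    have e1 : oscSin u 0 = 0 := rfl
    rw [← hu, oscSin_succ, e0, e1] at h
    rw [e0, e1, show (oscCos u a * 1 + u * (oscSin u a * 0)) * semicircle x / (a + (0 : ℕ) + 1) =
      ((a : ℝ) + 1)⁻¹ * ((oscCos u a * 1 - oscCos u (a + 1) * 0) * semicircle x) by
        push_cast; ring]
    refine h.congr' ?_
    filter_upwards [eventually_ge_atTop 1] with N hN
    rw [← waveKernel_christoffel_darboux (M := N + n) (by positivity) (by omega)]
    have : (a : ℝ) + 1 ≠ 0 := by positivity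
    simp
    field_simp
  | succ b ih =>
    have h := (((ih (a + 1)).const_mul ((b : ℝ) + 1)).add
      (rateLim_wronskian n hx (a + 1) (b + 1))).const_mul ((a : ℝ) + 1)⁻¹
    rw [← hu] at h
    simp only [oscCos_succ, oscSin_succ] at h ⊢
    have ha : (a : ℝ) + 1 ≠ 0 := by positivity
    have hab : (a : ℝ) + (b + 1) + 1 ≠ 0 := by positivity
    have hab' : (a : ℝ) + 1 + b + 1 ≠ 0 := by positivity
    convert! h.congr' ?_ using 1
    · push_cast
      field_simp
      ring
    · filter_upwards [eventually_ge_atTop 1] with N hN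
      rw [← waveKernel_christoffel_darboux (M := N + n) (by positivity) (by omega)]
      simp only [Nat.add_sub_cancel]
      push_cast
      field_simp
      ring

theorem oscCos_eq (w : ℝ) (a : ℕ) :
    oscCos (w ^ 2) a = (-1) ^ (a / 2) * w ^ a * ((1 + (-1) ^ a) / 2) ∧
      w * oscSin (w ^ 2) a = (-1) ^ (a / 2) * w ^ a * ((1 - (-1) ^ a) / 2) := by
  induction a using Nat.twoStepInduction with
  | zero => simp [oscCos, oscSin]
  | one => simp [oscCos, oscSin]
  | more a ih _ =>
    have h : (a + 2) / 2 = a / 2 + 1 := by omega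
    rw [oscSin_succ, oscCos_succ, oscCos_succ, oscSin_succ, h]
    constructor
    · rw [ih.1]; ring
    · linear_combination (-w ^ 2) * ih.2

theorem rateLim_hermiteKernel_self (n : ℕ) {x : ℝ} (hx : |x| < 1) (a b : ℕ) :
    RateLim (fun N : ℕ => hermiteKernel N (N + n) (weightedJet N a x) (weightedJet N b x) / N)
      ((-1) ^ (a / 2) * (2 * √(1 - x ^ 2)) ^ a * ((-1) ^ (b / 2) * (2 * √(1 - x ^ 2)) ^ b) *
        semicircle x * ((1 + (-1) ^ (a + b)) / (2 * (a + b + 1)))) := by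
  have hx2 : x ^ 2 < 1 := by rw [← sq_abs]; exact pow_lt_one₀ (abs_nonneg x) hx two_ne_zero
  have h := rateLim_hermiteKernel_of_waveKernel hx hx (rateLim_waveKernel_self n hx a b)
  have hu : 4 * (1 - x ^ 2) = (2 * √(1 - x ^ 2)) ^ 2 := by
    rw [mul_pow, Real.sq_sqrt (by linarith)]; norm_num
  rw [hu] at h
  convert! h using 1
  generalize 2 * √(1 - x ^ 2) = w
  rw [show w ^ 2 * (oscSin (w ^ 2) a * oscSin (w ^ 2) b) =
    (w * oscSin (w ^ 2) a) * (w * oscSin (w ^ 2) b) by ring, (oscCos_eq w a).1, (oscCos_eq w b).1,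
    (oscCos_eq w a).2, (oscCos_eq w b).2]
  have : (a : ℝ) + b + 1 ≠ 0 := by positivity
  field_simp
  ring

end JetLimits

section Hilbert

open Matrix

theorem prod_factorial_shift (n c : ℕ) :
    (∏ i ∈ range (n + 1), (i + c).factorial) * ((c + 1) * ∏ i ∈ range n, (i + c + 2) ^ 2) =
      (n + 1 + c).factorial * ∏ i ∈ range n, (i + c + 2).factorial := by
  induction n with
  | zero =>
    simp [add_comm 1 c, Nat.factorial_succ, mul_comm]
  | succ n ih =>
    rw [Finset.prod_range_succ (fun i => (i + c).factorial) (n + 1),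
      Finset.prod_range_succ (fun i => (i + c + 2) ^ 2) n,
      Finset.prod_range_succ (fun i => (i + c + 2).factorial) n,
      show n + 1 + 1 + c = (n + 1 + c) + 1 by ring, Nat.factorial_succ (n + 1 + c),
      show n + c + 2 = (n + 1 + c) + 1 by ring, Nat.factorial_succ (n + 1 + c)]
    linear_combination (n + 1 + c).factorial * (n + 1 + c + 1) ^ 2 * ih

/-- The determinant of a generalised Hilbert matrix. -/
theorem det_hilbert (n c : ℕ) :
    (of fun i j : Fin n => (1 : ℝ) / ((i : ℝ) + j + c + 1)).det =
      ∏ i ∈ range n, (i.factorial : ℝ) ^ 2 * (i + c).factorial / (i + n + c).factorial := by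
  induction n generalizing c with
  | zero => simp
  | succ n ih =>
    have hc (k : ℕ) : (k : ℝ) + c + 1 ≠ 0 := by positivity
    have h1 : (of fun i j : Fin (n + 1) => (1 : ℝ) / ((i : ℝ) + j + c + 1)).det =
        (of fun i j : Fin (n + 1) => if i = 0 then (1 : ℝ) / (j + c + 1) else
          (i : ℝ) * j / (((i : ℝ) + j + c + 1) * (i + c + 1) * (j + c + 1))).det := by
      refine det_eq_of_forall_row_eq_smul_add_const
        (fun i => if i = 0 then 0 else ((c : ℝ) + 1) / (i + c + 1)) 0 (by simp) fun i j => ?_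
      by_cases hi : i = 0
      · simp [hi]
      · have := hc i
        have := hc j
        have : (i : ℝ) + j + c + 1 ≠ 0 := by positivity
        simp only [of_apply, hi, if_false, if_true]
        field_simp
        ring
    have h2 : (of fun i j : Fin n => ((i : ℝ) + 1) / (i + c + 2) * (((j : ℝ) + 1) / (j + c + 2) *
        (1 / ((i : ℝ) + j + (c + 2 : ℕ) + 1)))).det =
        (∏ i : Fin n, ((i : ℝ) + 1) / (i + c + 2)) * ((∏ i : Fin n, ((i : ℝ) + 1) / (i + c + 2)) *
          (of fun i j : Fin n => (1 : ℝ) / ((i : ℝ) + j + (c + 2 : ℕ) + 1)).det) := by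
      rw [← det_mul_row, ← det_mul_column]
      rfl
    rw [h1, det_succ_column_zero, Fin.sum_univ_succ, Finset.sum_eq_zero (fun i _ => by simp)]
    have h3 : (submatrix (of fun i j : Fin (n + 1) => if i = 0 then (1 : ℝ) / (j + c + 1) else
          (i : ℝ) * j / (((i : ℝ) + j + c + 1) * (i + c + 1) * (j + c + 1)))
            (Fin.succAbove 0) Fin.succ) = of fun i j : Fin n => ((i : ℝ) + 1) / (i + c + 2) *
              (((j : ℝ) + 1) / (j + c + 2) * (1 / ((i : ℝ) + j + (c + 2 : ℕ) + 1))) := by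
      ext i j
      simp only [submatrix_apply, of_apply, Fin.succAbove_zero, Fin.succ_ne_zero, if_false,
        Fin.val_succ]
      push_cast
      field_simp
      ring
    rw [h3, h2, ih, Fin.prod_univ_eq_prod_range
        (fun i => ((i : ℝ) + 1) / (i + c + 2))]
    have hs : ((∏ i ∈ range (n + 1), ((i + c).factorial : ℝ)) *
        ((c + 1) * ∏ i ∈ range n, ((i : ℝ) + c + 2) ^ 2)) =
        (n + 1 + c).factorial * ∏ i ∈ range n, ((i + c + 2).factorial : ℝ) := by
      exact_mod_cast prod_factorial_shift n c
    have hf : (∏ i ∈ range n, ((i : ℝ) + 1)) = n.factorial := by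
      rw [← Finset.prod_range_add_one_eq_factorial]; push_cast; rfl
    have hd : (∏ i ∈ range (n + 1), ((i + (n + 1) + c).factorial : ℝ)) =
        (∏ i ∈ range n, ((i + n + (c + 2)).factorial : ℝ)) * (n + 1 + c).factorial := by
      rw [Finset.prod_range_succ']
      congr 1
      · refine Finset.prod_congr rfl fun i _ => ?_
        congr 2; ring
      · simp
    rw [Finset.prod_pow] at hs
    simp only [Finset.prod_div_distrib, Finset.prod_mul_distrib, hf, hd]
    rw [Finset.prod_range_succ (fun i => (i.factorial : ℝ) ^ 2)]
    have p1 : (∏ i ∈ range n, ((i : ℝ) + c + 2)) ≠ 0 :=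
      Finset.prod_ne_zero_iff.2 fun i _ => by positivity
    have p2 : (∏ i ∈ range n, ((i + n + (c + 2)).factorial : ℝ)) ≠ 0 :=
      Finset.prod_ne_zero_iff.2 fun i _ => by positivity
    have p3 : ((n + 1 + c).factorial : ℝ) ≠ 0 := by positivity
    have hs' : (∏ i ∈ range n, ((i + (c + 2)).factorial : ℝ)) =
      ∏ i ∈ range n, ((i + c + 2).factorial : ℝ) := rfl
    have p4 : (c : ℝ) + 1 ≠ 0 := by positivity
    rw [hs']
    simp only [of_apply, if_true, Fin.val_zero, pow_zero, Nat.cast_zero, zero_add, add_zero]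
    field_simp
    linear_combination -hs

end Hilbert

section SineMoments

open Matrix Polynomial

theorem integral_two_mul_sub_one_pow (k : ℕ) :
    ∫ x in (0 : ℝ)..1, (2 * x - 1) ^ k = (1 + (-1) ^ k) / (2 * (k + 1)) := by
  have h := intervalIntegral.integral_comp_mul_sub (a := 0) (b := 1) (fun x : ℝ => x ^ k)
    (two_ne_zero : (2 : ℝ) ≠ 0) 1
  rw [h, integral_pow]
  norm_num
  have : (k : ℝ) + 1 ≠ 0 := by positivity
  field_simp
  ring

theorem natDegree_linear_pow {b : ℝ} (hb : b ≠ 0) (c : ℝ) (a : ℕ) :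
    ((C b * X + C c : ℝ[X]) ^ a).natDegree = a := by
  rw [natDegree_pow, natDegree_linear hb, mul_one]

theorem coeff_linear_pow_self {b : ℝ} (hb : b ≠ 0) (c : ℝ) (a : ℕ) :
    ((C b * X + C c : ℝ[X]) ^ a).coeff a = b ^ a := by
  have h := leadingCoeff_pow (C b * X + C c : ℝ[X]) a
  rwa [leadingCoeff, natDegree_linear_pow hb, leadingCoeff_linear hb] at h

theorem det_sine_moments (n : ℕ) :
    (of fun a b : Fin n => (1 + (-1 : ℝ) ^ ((a : ℕ) + b)) / (2 * ((a : ℝ) + b + 1))).det =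
      ∏ i ∈ range n, 2 ^ (2 * i) * (i.factorial : ℝ) ^ 3 / (i + n).factorial := by
  obtain ⟨B, hB⟩ : ∃ B : Matrix (Fin n) (Fin n) ℝ,
      ∀ a c, B a c = ((C 2 * X + C (-1) : ℝ[X]) ^ (a : ℕ)).coeff c :=
    ⟨of fun _ _ => _, fun _ _ => rfl⟩
  have hBdet : B.det = ∏ i : Fin n, 2 ^ (i : ℕ) := by
    rw [det_of_isLowerTriangular B fun i j hij => ?_]
    · exact Finset.prod_congr rfl fun i _ =>
        (hB i i).trans (coeff_linear_pow_self two_ne_zero _ _)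
    · rw [hB]
      refine coeff_eq_zero_of_natDegree_lt ?_
      rw [natDegree_linear_pow two_ne_zero]
      exact hij
  have heval (a : Fin n) (x : ℝ) : (2 * x - 1) ^ (a : ℕ) = ∑ c, B a c * x ^ (c : ℕ) := by
    have h := eval_eq_sum_range' (p := (C 2 * X + C (-1) : ℝ[X]) ^ (a : ℕ)) (n := n)
      (by rw [natDegree_linear_pow two_ne_zero]; exact a.2) x
    simp only [hB]
    rw [Fin.sum_univ_eq_sum_range
      (fun c => ((C 2 * X + C (-1) : ℝ[X]) ^ (a : ℕ)).coeff c * x ^ c), ← h]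
    simp [sub_eq_add_neg]
  have hmul : (of fun a b : Fin n => (1 + (-1 : ℝ) ^ ((a : ℕ) + b)) / (2 * ((a : ℝ) + b + 1))) =
      B * (of fun i j : Fin n => (1 : ℝ) / ((i : ℝ) + j + (0 : ℕ) + 1)) * Bᵀ := by
    ext a b
    have h := integral_two_mul_sub_one_pow ((a : ℕ) + b)
    push_cast at h
    rw [of_apply, ← h, mul_apply]
    simp only [mul_apply, transpose_apply, of_apply, pow_add, heval, Finset.sum_mul]
    rw [intervalIntegral.integral_finsetSum fun c _ => by
      exact Continuous.intervalIntegrable (by fun_prop) _ _, Finset.sum_comm]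
    refine Finset.sum_congr rfl fun d _ => ?_
    simp only [Finset.mul_sum]
    rw [intervalIntegral.integral_finsetSum fun c _ => by
      exact Continuous.intervalIntegrable (by fun_prop) _ _]
    refine Finset.sum_congr rfl fun c _ => ?_
    have e (x : ℝ) : B a d * x ^ (d : ℕ) * (B b c * x ^ (c : ℕ)) =
      B a d * B b c * x ^ ((d : ℕ) + c) := by ring
    simp only [e, intervalIntegral.integral_const_mul, integral_pow]
    push_cast
    simp
    ring
  rw [hmul, det_mul, det_mul, det_transpose, det_hilbert, hBdet,
    Fin.prod_univ_eq_prod_range (fun i => (2 : ℝ) ^ i), mul_comm, ← mul_assoc,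
    ← Finset.prod_mul_distrib, ← Finset.prod_mul_distrib]
  refine Finset.prod_congr rfl fun i _ => ?_
  simp only [add_zero]
  ring

end SineMoments

section LimitDeterminant

open Matrix

theorem det_sigma_block {m : ℕ} (q : Fin m → ℕ) (F : Fin m → ℕ → ℕ → ℝ) :
    (of fun s s' : (i : Fin m) × Fin (q i) => if s.1 = s'.1 then F s.1 s.2 s'.2 else 0).det =
      ∏ i, (of fun a b : Fin (q i) => F i a b).det := by
  refine (BlockTriangular.det_fintype (b := Sigma.fst) fun s s' h => if_neg h.ne').trans ?_
  refine Finset.prod_congr rfl fun i _ => ?_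
  let e : Fin (q i) ≃ {s : (i : Fin m) × Fin (q i) // s.1 = i} :=
    { toFun := fun a => ⟨⟨i, a⟩, rfl⟩
      invFun := fun s => Fin.cast (by rw [s.2]) s.1.2
      left_inv := fun a => rfl
      right_inv := by rintro ⟨⟨i, a⟩, rfl⟩; rfl }
  rw [← det_submatrix_equiv_self e]
  congr 1
  ext a b
  exact if_pos rfl

theorem prod_Icc_factorial (n : ℕ) :
    ∏ l ∈ Icc 1 (n - 1), (l.factorial : ℝ) = ∏ l ∈ range n, (l.factorial : ℝ) := by
  induction n with
  | zero => simp
  | succ n ih =>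
    rcases n with _ | n
    · simp
    · rw [Finset.prod_range_succ, ← ih]
      exact Finset.prod_Icc_succ_top (by omega) _

/-- The limit of the rescaled kernel at a single bulk point. -/
noncomputable def sineJet (x : ℝ) (a b : ℕ) : ℝ :=
  (-1) ^ (a / 2) * (2 * √(1 - x ^ 2)) ^ a * ((-1) ^ (b / 2) * (2 * √(1 - x ^ 2)) ^ b) *
    semicircle x * ((1 + (-1) ^ (a + b)) / (2 * (a + b + 1)))

theorem det_sineJet (x : ℝ) (n : ℕ) :
    (of fun a b : Fin n => sineJet x a b).det =
      (∏ i ∈ range n, (i.factorial : ℝ)) ^ 2 *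
        ((∏ l ∈ Icc 1 (n - 1), (l.factorial : ℝ)) ^ 2 /
          (∏ l ∈ Icc 1 (2 * n - 1), (l.factorial : ℝ)) * (2 * Real.pi) ^ (n ^ 2 - n)) *
        semicircle x ^ (n ^ 2) := by
  set w : ℝ := 2 * √(1 - x ^ 2) with hw
  have hwρ : w = Real.pi * semicircle x := by
    rw [hw, semicircle]
    field_simp
  have h : (of fun a b : Fin n => sineJet x a b).det =
      (∏ a : Fin n, (-1) ^ ((a : ℕ) / 2) * w ^ (a : ℕ)) *
        ((∏ a : Fin n, (-1) ^ ((a : ℕ) / 2) * w ^ (a : ℕ)) * (semicircle x ^ n *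
          (of fun a b : Fin n => (1 + (-1 : ℝ) ^ ((a : ℕ) + b)) / (2 * ((a : ℝ) + b + 1))).det)) :=
      by
    have hs := det_smul (of fun a b : Fin n =>
      (1 + (-1 : ℝ) ^ ((a : ℕ) + b)) / (2 * ((a : ℝ) + b + 1))) (semicircle x)
    rw [Fintype.card_fin] at hs
    rw [← hs, ← det_mul_row, ← det_mul_column]
    congr 1
    ext a b
    simp only [sineJet, of_apply, Matrix.smul_apply, smul_eq_mul, ← hw]
    ring
  have hsum : ∑ i ∈ range n, 2 * i = n ^ 2 - n := by
    rw [← Finset.mul_sum, mul_comm, Finset.sum_range_id_mul_two, Nat.mul_sub_one, sq]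
  have hle : n ≤ n ^ 2 := Nat.le_self_pow two_ne_zero n
  have hpow : semicircle x ^ n * semicircle x ^ (n ^ 2 - n) = semicircle x ^ (n ^ 2) := by
    rw [← pow_add, Nat.add_sub_cancel' hle]
  have hprod : (∏ i ∈ range n, (2 : ℝ) ^ (2 * i) * (w ^ i) ^ 2) =
      (2 * Real.pi) ^ (n ^ 2 - n) * semicircle x ^ (n ^ 2 - n) := by
    rw [← mul_pow, ← hsum, ← Finset.prod_pow_eq_pow_sum]
    refine Finset.prod_congr rfl fun i _ => ?_
    rw [hwρ]
    ring
  have hsign : (∏ a : Fin n, (-1) ^ ((a : ℕ) / 2) * w ^ (a : ℕ)) ^ 2 =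
      ∏ i ∈ range n, (w ^ i) ^ 2 := by
    rw [Fin.prod_univ_eq_prod_range (fun i => (-1) ^ (i / 2) * w ^ i), ← Finset.prod_pow]
    refine Finset.prod_congr rfl fun i _ => ?_
    rw [mul_pow, ← pow_mul, mul_comm (i / 2), pow_mul, neg_one_sq, one_pow, one_mul]
  have hadd : ∏ l ∈ range (2 * n), (l.factorial : ℝ) =
      (∏ l ∈ range n, (l.factorial : ℝ)) * ∏ l ∈ range n, ((l + n).factorial : ℝ) := by
    rw [two_mul, Finset.prod_range_add]
    simp only [add_comm n]
  rw [h, det_sine_moments, prod_Icc_factorial, prod_Icc_factorial, hadd, ← hpow]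
  simp only [Finset.prod_div_distrib, Finset.prod_mul_distrib, Finset.prod_pow] at hprod hsign ⊢
  have p1 : (∏ l ∈ range n, (l.factorial : ℝ)) ≠ 0 :=
    Finset.prod_ne_zero_iff.2 fun i _ => by positivity
  have p2 : (∏ l ∈ range n, ((l + n).factorial : ℝ)) ≠ 0 :=
    Finset.prod_ne_zero_iff.2 fun i _ => by positivity
  rw [← hsign] at hprod
  field_simp
  linear_combination semicircle x ^ n * hprod

theorem det_sineJet_pos {x : ℝ} (hx : |x| < 1) (n : ℕ) :
    0 < (of fun a b : Fin n => sineJet x a b).det := by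
  have hs := semicircle_pos hx
  rw [det_sineJet]
  positivity

end LimitDeterminant

section Assembly

open Matrix

theorem rateLim_factorial_add_div (n : ℕ) :
    RateLim (fun N => ((N + n).factorial : ℝ) / (N.factorial * N ^ n)) 1 := by
  induction n with
  | zero =>
    refine (rateLim_const 1).congr fun N => ?_
    have : (N.factorial : ℝ) ≠ 0 := by positivity
    field_simp
    simp
  | succ n ih =>
    rw [← one_mul (1 : ℝ)]
    refine (ih.mul (rateLim_natCast_add_div n 1)).congr fun N => ?_
    rw [← add_assoc, Nat.factorial_succ, pow_succ]
    push_cast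
    ring

variable {m : ℕ} (q : Fin m → ℕ) (μ : Fin m → ℝ)

theorem rateLim_det_hermiteKernel (hμ : ∀ i, |μ i| < 1) (hinj : Function.Injective μ) :
    RateLim (fun N => (of fun s s' : (i : Fin m) × Fin (q i) =>
        hermiteKernel N (N + ∑ i, q i) (weightedJet N s.2 (μ s.1))
          (weightedJet N s'.2 (μ s'.1))).det / (N : ℝ) ^ (∑ i, q i))
      (∏ i, (of fun a b : Fin (q i) => sineJet (μ i) a b).det) := by
  rw [← det_sigma_block q fun i => sineJet (μ i)]
  have h : RateLim (fun N => (of fun s s' : (i : Fin m) × Fin (q i) =>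
      hermiteKernel N (N + ∑ i, q i) (weightedJet N s.2 (μ s.1))
        (weightedJet N s'.2 (μ s'.1)) / (N : ℝ)).det)
      (of fun s s' : (i : Fin m) × Fin (q i) =>
        if s.1 = s'.1 then sineJet (μ s.1) s.2 s'.2 else 0).det := by
    refine RateLim.det fun s s' => ?_
    simp only [of_apply]
    split_ifs with hs
    · rcases s with ⟨i, a⟩
      rcases s' with ⟨i', b⟩
      obtain rfl : i = i' := hs
      exact rateLim_hermiteKernel_self _ (hμ _) _ _
    · exact rateLim_hermiteKernel_of_waveKernel (hμ _) (hμ _)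
        (rateLim_waveKernel_of_ne _ (hμ _) (hμ _) (hinj.ne hs) _ _)
  refine h.congr fun N => ?_
  have hd := det_smul (of fun s s' : (i : Fin m) × Fin (q i) =>
      hermiteKernel N (N + ∑ i, q i) (weightedJet N s.2 (μ s.1))
        (weightedJet N s'.2 (μ s'.1))) (N : ℝ)⁻¹
  simp only [Fintype.card_sigma, Fintype.card_fin, inv_pow] at hd
  rw [div_eq_inv_mul, ← hd]
  congr 1
  ext s s'
  simp only [of_apply, Matrix.smul_apply, smul_eq_mul]
  ring

theorem sq_prod_jet_factor (i : Fin m) {t : ℝ} (ht : 0 < t) (hinj : Function.Injective μ) :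
    (∏ a : Fin (q i), ((a : ℕ).factorial * Real.exp (-t * μ i ^ 2) / t ^ (a : ℕ) *
        ∏ j ∈ Iio i, (μ i - μ j) ^ q j)) ^ 2 *
      (t ^ (q i ^ 2 - q i) * Real.exp (2 * t * q i * μ i ^ 2) *
        ∏ j ∈ Iio i, |μ i - μ j| ^ (-(2 * (q j : ℤ) * (q i : ℤ)))) =
      (∏ a ∈ range (q i), (a.factorial : ℝ)) ^ 2 := by
  have hsum : ∑ a ∈ range (q i), 2 * a = q i ^ 2 - q i := by
    rw [← Finset.mul_sum, mul_comm, Finset.sum_range_id_mul_two, Nat.mul_sub_one, sq]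
  have hpow : (∏ a ∈ range (q i), t ^ a) ^ 2 = t ^ (q i ^ 2 - q i) := by
    rw [← hsum, ← Finset.prod_pow_eq_pow_sum, ← Finset.prod_pow]
    exact Finset.prod_congr rfl fun a _ => by ring
  have hexp : (Real.exp (-t * μ i ^ 2) ^ q i) ^ 2 * Real.exp (2 * t * q i * μ i ^ 2) = 1 := by
    rw [← Real.exp_nat_mul, ← Real.exp_nat_mul, ← Real.exp_add, Real.exp_eq_one_iff]
    push_cast
    ring
  have hvand : ((∏ j ∈ Iio i, (μ i - μ j) ^ q j) ^ q i) ^ 2 *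
      ∏ j ∈ Iio i, |μ i - μ j| ^ (-(2 * (q j : ℤ) * (q i : ℤ))) = 1 := by
    rw [← Finset.prod_pow, ← Finset.prod_pow, ← Finset.prod_mul_distrib]
    refine Finset.prod_eq_one fun j hj => ?_
    have hne : |μ i - μ j| ≠ 0 :=
      abs_ne_zero.2 (sub_ne_zero.2 (hinj.ne (Finset.mem_Iio.1 hj).ne'))
    rw [← sq_abs, abs_pow, abs_pow, ← pow_mul, ← pow_mul, ← zpow_natCast, ← zpow_add₀ hne]
    convert zpow_zero _ using 2
    push_cast
    ring
  have hp : ∏ a : Fin (q i), ((a : ℕ).factorial * Real.exp (-t * μ i ^ 2) / t ^ (a : ℕ) *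
      ∏ j ∈ Iio i, (μ i - μ j) ^ q j) = (∏ a ∈ range (q i), (a.factorial : ℝ)) *
        Real.exp (-t * μ i ^ 2) ^ q i / (∏ a ∈ range (q i), t ^ a) *
          (∏ j ∈ Iio i, (μ i - μ j) ^ q j) ^ q i := by
    rw [Fin.prod_univ_eq_prod_range (fun a => (a.factorial : ℝ) * Real.exp (-t * μ i ^ 2) / t ^ a *
      ∏ j ∈ Iio i, (μ i - μ j) ^ q j)]
    simp only [Finset.prod_mul_distrib, Finset.prod_div_distrib, Finset.prod_const, card_range]
  have ht' : t ^ (q i ^ 2 - q i) ≠ 0 := by positivity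
  rw [hp, mul_pow, div_pow, hpow, mul_pow]
  clear hp hpow
  generalize (Real.exp (-t * μ i ^ 2) ^ q i) ^ 2 = E at *
  generalize Real.exp (2 * t * q i * μ i ^ 2) = E' at *
  generalize ((∏ j ∈ Iio i, (μ i - μ j) ^ q j) ^ q i) ^ 2 = V at *
  generalize ∏ j ∈ Iio i, |μ i - μ j| ^ (-(2 * (q j : ℤ) * (q i : ℤ))) = V' at *
  field_simp
  linear_combination V * V' * hexp + hvand

theorem sq_prod_jet_factor_mul_amplitude {t : ℝ} (ht : 0 < t) (hinj : Function.Injective μ) :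
    (∏ s : (i : Fin m) × Fin (q i),
        ((s.2 : ℕ).factorial * Real.exp (-t * μ s.1 ^ 2) / t ^ (s.2 : ℕ) *
          ∏ j ∈ Iio s.1, (μ s.1 - μ j) ^ q j)) ^ 2 *
      (t ^ (∑ i, ((q i) ^ 2 - q i)) *
        (∏ i, Real.exp (2 * t * (q i) * (μ i) ^ 2)) *
        (∏ i, (∏ l ∈ Finset.Icc 1 (q i - 1), (l.factorial : ℝ)) ^ 2 /
            (∏ l ∈ Finset.Icc 1 (2 * q i - 1), (l.factorial : ℝ)) *
            (2 * Real.pi) ^ ((q i) ^ 2 - q i)) *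
        (∏ j : Fin m, ∏ k ∈ Finset.Ioi j,
            |μ k - μ j| ^ (-(2 * (q j : ℤ) * (q k : ℤ)))) *
        ∏ i, ((2 / Real.pi) * Real.sqrt (1 - (μ i) ^ 2)) ^ ((q i) ^ 2)) =
      ∏ i, (of fun a b : Fin (q i) => sineJet (μ i) a b).det := by
  rw [Fintype.prod_sigma, ← Finset.prod_pow_eq_pow_sum,
    Finset.prod_comm' (t' := univ) (s' := fun k => Iio k) (by simp), ← Finset.prod_pow,
    ← Finset.prod_mul_distrib, ← Finset.prod_mul_distrib, ← Finset.prod_mul_distrib,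
    ← Finset.prod_mul_distrib, ← Finset.prod_mul_distrib]
  refine Finset.prod_congr rfl fun i _ => ?_
  rw [det_sineJet, ← sq_prod_jet_factor q μ i ht hinj, semicircle]
  ring

theorem div_eq_div_of_mul_eq {H H' A P K f f' w : ℝ} (hH' : H' ≠ 0) (hA : A ≠ 0) (hP : P ≠ 0)
    (hf : f ≠ 0) (hw : w ≠ 0) (h : H * (f * P) = H' * (f' * K)) :
    K / w / (P * A) / (f / (f' * w)) = H / (H' * A) := by
  field_simp
  linear_combination -h

end Assembly

/-- Forrester–Frankel asymptotics, Hermite case, integer `q`.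
For the Hermite weight `ω_N(x)=e^{-2Nx²}` on `ℝ` and pairwise distinct
`μ_i ∈ (-1,1)`, the ratio `H_{N,N,m,q}(μ)/(H_{N+|q|,N}·A_N)` is `1 + O(1/N)`, where
`A_N = N^{Σ(q_i²-q_i)} ∏ e^{2Nq_iμ_i²} ∏ [G²(q_i+1)/G(2q_i+1)](2π)^{q_i²-q_i}
  ∏_{j<k}|μ_k-μ_j|^{-2q_jq_k} ∏ ρ(μ_i)^{q_i²}` with `ρ(μ) = (2/π)√(1-μ²)`. -/
theorem forrester_frankel_hermite
    (m : ℕ) (hm : 1 ≤ m) (q : Fin m → ℕ) (hq : ∀ i, 1 ≤ q i)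
    (μ : Fin m → ℝ) (hμmem : ∀ i, μ i ∈ Set.Ioo (-1 : ℝ) 1)
    (hμinj : Function.Injective μ) :
    ∃ C > (0 : ℝ), ∃ N₀ : ℕ, ∀ N ≥ N₀,
      |(∫ z : Fin N → ℝ,
            vandR z ^ 2 * (∏ l, Real.exp (-2 * N * (z l) ^ 2)) *
              ∏ l, ∏ i, |μ i - z l| ^ (2 * q i)) /
          ((∫ z : Fin (N + ∑ i, q i) → ℝ,
              vandR z ^ 2 * ∏ l, Real.exp (-2 * N * (z l) ^ 2)) *
            ((N : ℝ) ^ (∑ i, ((q i) ^ 2 - q i)) *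
              (∏ i, Real.exp (2 * N * (q i) * (μ i) ^ 2)) *
              (∏ i, (∏ l ∈ Finset.Icc 1 (q i - 1), (l.factorial : ℝ)) ^ 2 /
                  (∏ l ∈ Finset.Icc 1 (2 * q i - 1), (l.factorial : ℝ)) *
                  (2 * Real.pi) ^ ((q i) ^ 2 - q i)) *
              (∏ j : Fin m, ∏ k ∈ Finset.Ioi j,
                  |μ k - μ j| ^ (-(2 * (q j : ℤ) * (q k : ℤ)))) *
              ∏ i, ((2 / Real.pi) * Real.sqrt (1 - (μ i) ^ 2)) ^ ((q i) ^ 2))) - 1| ≤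
        C / N := by
  have hμ (i : Fin m) : |μ i| < 1 := abs_lt.2 (hμmem i)
  have hL : ∏ i, (Matrix.of fun a b : Fin (q i) => sineJet (μ i) a b).det ≠ 0 :=
    Finset.prod_ne_zero_iff.2 fun i _ => (det_sineJet_pos (hμ i) (q i)).ne'
  have hlim := ((rateLim_det_hermiteKernel q μ hμ hμinj).div (rateLim_const _) hL).div
    (rateLim_factorial_add_div (∑ i, q i)) one_ne_zero
  rw [div_self hL, div_one] at hlim
  refine RateLim.exists_abs_sub_le (hlim.congr' ?_)
  filter_upwards [Filter.eventually_gt_atTop 0] with N hN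
  have ht : (0 : ℝ) < N := Nat.cast_pos.2 hN
  have hkey := integral_nodes_mul_eq q μ ht N
  have hamp := sq_prod_jet_factor_mul_amplitude q μ ht hμinj
  have hM : (∫ z : Fin (N + ∑ i, q i) → ℝ,
      vandR z ^ 2 * ∏ l, Real.exp (-2 * N * (z l) ^ 2)) ≠ 0 := by
    rw [integral_vandR_sq ht]
    exact mul_ne_zero (by positivity)
      (Finset.prod_ne_zero_iff.2 fun k _ => (hermiteNorm_pos ht k).ne')
  rw [← hamp] at hL ⊢
  obtain ⟨hP, hA⟩ := mul_ne_zero_iff.1 hL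
  exact div_eq_div_of_mul_eq hM hA hP (by positivity) (by positivity) hkey
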